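/- arXiv:1907.13479 — 3 statements merged into one kernel-verified Lean document; each statement's English description precedes it below -/
import Mathlib

section
/- (Bang–Zsigmondy) Let a and m be integers with |a| > 1 and m ≥ 1. Then the set R_m(a) of primitive prime divisors of a^m − 1 is nonempty, except when (a,m) ∈ {(2,1), (2,6), (−2,2), (−2,3), (3,1), (−3,2)}. -/
/-- `eOrd r a` : for an odd prime `r`, the multiplicative order of `a` modulo `r`
(i.e. the least `m ≥ 1` with `r ∣ a ^ m - 1`, and `0` if no such `m` exists);
for `r = 2`, it is `1` if `4 ∣ a - 1`, `2` if `4 ∣ a + 1`, and `0` otherwise. -/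
noncomputable def eOrd (r : ℕ) (a : ℤ) : ℕ :=
  if r = 2 then (if (4 : ℤ) ∣ a - 1 then 1 else if (4 : ℤ) ∣ a + 1 then 2 else 0)
  else sInf {m : ℕ | 0 < m ∧ (r : ℤ) ∣ a ^ m - 1}

/-- `Rset m a` : the set of primitive prime divisors of `a ^ m - 1`,
i.e. the primes `r` with `eOrd r a = m`. -/
noncomputable def Rset (m : ℕ) (a : ℤ) : Set ℕ := {r | r.Prime ∧ eOrd r a = m}

open Polynomial

theorem eOrd_eq_iff {r : ℕ} (hr : r ≠ 2) (a : ℤ) {m : ℕ} (hm : 0 < m) :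
    eOrd r a = m ↔ (r : ℤ) ∣ a ^ m - 1 ∧ ∀ j, 0 < j → j < m → ¬ (r : ℤ) ∣ a ^ j - 1 := by
  rw [eOrd, if_neg hr]
  constructor
  · rintro rfl
    exact ⟨(Nat.sInf_mem (Nat.nonempty_of_pos_sInf hm)).2,
      fun j hj hlt h => Nat.notMem_of_lt_sInf hlt ⟨hj, h⟩⟩
  · rintro ⟨h, hmin⟩
    refine le_antisymm (Nat.sInf_le ⟨hm, h⟩) (le_csInf ⟨m, hm, h⟩ fun j hj => ?_)
    by_contra! hlt
    exact hmin j hj.1 hlt hj.2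

theorem Int.exists_odd_prime_dvd {x : ℤ} (h4 : ¬ 4 ∣ x) (h1 : x.natAbs ≠ 1)
    (h2 : x.natAbs ≠ 2) : ∃ p : ℕ, p.Prime ∧ p ≠ 2 ∧ (p : ℤ) ∣ x := by
  obtain ⟨p, hp, hpx⟩ := Nat.exists_prime_and_dvd h1
  rcases eq_or_ne p 2 with rfl | hp2
  · obtain ⟨y, hy⟩ := hpx
    obtain ⟨q, hq, z, hz⟩ := Nat.exists_prime_and_dvd (n := y) (by omega)
    refine ⟨q, hq, ?_, Int.natCast_dvd.2 ⟨2 * z, by rw [hy, hz]; ring⟩⟩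
    rintro rfl
    omega
  · exact ⟨p, hp, hp2, Int.natCast_dvd.2 hpx⟩

theorem Polynomial.abs_eval_cyclotomic_eq_prod {n : ℕ} (hn : n ≠ 0) (q : ℤ) :
    |(((cyclotomic n ℤ).eval q : ℤ) : ℝ)| = ∏ ζ ∈ primitiveRoots n ℂ, ‖(q : ℂ) - ζ‖ := by
  have h : (((cyclotomic n ℤ).eval q : ℤ) : ℂ) = ∏ ζ ∈ primitiveRoots n ℂ, ((q : ℂ) - ζ) := by
    have h' := congrArg (eval (q : ℂ))
      (cyclotomic_eq_prod_X_sub_primitiveRoots (Complex.isPrimitiveRoot_exp n hn))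
    rw [eval_prod] at h'
    simp only [eval_sub, eval_X, eval_C] at h'
    rw [← h', ← map_cyclotomic_int n ℂ, eval_intCast_map, eq_intCast, Int.cast_id]
  rw [← norm_prod, ← h, Complex.norm_intCast]

theorem norm_eq_one_of_mem_primitiveRoots {n : ℕ} (hn : n ≠ 0) {ζ : ℂ}
    (h : ζ ∈ primitiveRoots n ℂ) : ‖ζ‖ = 1 :=
  ((mem_primitiveRoots (Nat.pos_of_ne_zero hn)).1 h).norm'_eq_one hn

theorem Polynomial.abs_eval_cyclotomic_le {n : ℕ} (hn : n ≠ 0) (q : ℤ) :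
    |(cyclotomic n ℤ).eval q| ≤ (|q| + 1) ^ n.totient := by
  have h : |(((cyclotomic n ℤ).eval q : ℤ) : ℝ)| ≤ (|(q : ℝ)| + 1) ^ n.totient := by
    rw [abs_eval_cyclotomic_eq_prod hn, ← Complex.card_primitiveRoots n, ← Finset.prod_const]
    refine Finset.prod_le_prod (fun _ _ => norm_nonneg _) fun ζ hζ => ?_
    have := norm_sub_le (q : ℂ) ζ
    rwa [Complex.norm_intCast, norm_eq_one_of_mem_primitiveRoots hn hζ] at this
  exact_mod_cast h

theorem Polynomial.le_abs_eval_cyclotomic {n : ℕ} (hn : n ≠ 0) {q : ℤ} (hq : 1 ≤ |q|) :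
    (|q| - 1) ^ n.totient ≤ |(cyclotomic n ℤ).eval q| := by
  have hq' : (1 : ℝ) ≤ |(q : ℝ)| := by exact_mod_cast hq
  have h : (|(q : ℝ)| - 1) ^ n.totient ≤ |(((cyclotomic n ℤ).eval q : ℤ) : ℝ)| := by
    rw [abs_eval_cyclotomic_eq_prod hn, ← Complex.card_primitiveRoots n, ← Finset.prod_const]
    refine Finset.prod_le_prod (fun _ _ => by linarith) fun ζ hζ => ?_
    have := norm_sub_norm_le (q : ℂ) ζ
    rwa [Complex.norm_intCast, norm_eq_one_of_mem_primitiveRoots hn hζ] at this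
  exact_mod_cast h

theorem abs_sub_one_lt_norm_sub {q : ℝ} (hq : q ≠ 0) {ζ : ℂ} (hζ : ‖ζ‖ = 1)
    (him : ζ.im ≠ 0) : |q| - 1 < ‖(q : ℂ) - ζ‖ := by
  apply lt_of_pow_lt_pow_left₀ 2 (norm_nonneg _)
  have h1 : ζ.re ^ 2 + ζ.im ^ 2 = 1 := by
    have := Complex.sq_norm ζ
    rw [hζ, Complex.normSq_apply] at this
    linarith
  have h2 : ‖(q : ℂ) - ζ‖ ^ 2 = (q - ζ.re) ^ 2 + ζ.im ^ 2 := by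
    rw [Complex.sq_norm, Complex.normSq_apply]
    simp
    ring
  have h3 : |ζ.re| < 1 := by
    rw [← sq_lt_one_iff_abs_lt_one]
    have := pow_pos (abs_pos.2 him) 2
    rw [sq_abs] at this
    linarith
  have h4 : q * ζ.re < |q| := by
    calc q * ζ.re ≤ |q * ζ.re| := le_abs_self _
      _ = |q| * |ζ.re| := abs_mul _ _
      _ < |q| := mul_lt_of_lt_one_right (abs_pos.2 hq) h3
  rw [h2, sub_sq, sq_abs]
  nlinarith

theorem Polynomial.lt_abs_eval_cyclotomic {n : ℕ} (hn : 3 ≤ n) {q : ℤ} (hq : 1 < |q|) :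
    (|q| - 1) ^ n.totient < |(cyclotomic n ℤ).eval q| := by
  have hn0 : n ≠ 0 := by omega
  have hq' : (1 : ℝ) < |(q : ℝ)| := by exact_mod_cast hq
  have hq0 : (q : ℝ) ≠ 0 := by
    intro h
    rw [h, abs_zero] at hq'
    linarith
  have h : (|(q : ℝ)| - 1) ^ n.totient < |(((cyclotomic n ℤ).eval q : ℤ) : ℝ)| := by
    rw [abs_eval_cyclotomic_eq_prod hn0, ← Complex.card_primitiveRoots n, ← Finset.prod_const]
    refine Finset.prod_lt_prod_of_nonempty (fun _ _ => by linarith) (fun ζ hζ => ?_)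
      ⟨_, (mem_primitiveRoots (by omega)).2 (Complex.isPrimitiveRoot_exp n hn0)⟩
    have h1 := norm_eq_one_of_mem_primitiveRoots hn0 hζ
    have := abs_sub_one_lt_norm_sub hq0 h1 (fun him => ?_)
    · simpa using this
    have hsq : ζ ^ 2 = 1 := by
      have hre := Complex.sq_norm ζ
      rw [h1, Complex.normSq_apply, him] at hre
      apply Complex.ext <;> simp [pow_two, him]
      linarith
    have := Nat.le_of_dvd two_pos
      (((mem_primitiveRoots (by omega)).1 hζ).dvd_of_pow_eq_one 2 hsq)
    omega
  exact_mod_cast h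

theorem isPrimitiveRoot_of_dvd_eval_cyclotomic {r k n : ℕ} [Fact r.Prime] (hn : ¬ r ∣ n)
    {a : ℤ} (h : (r : ℤ) ∣ (cyclotomic (r ^ k * n) ℤ).eval a) :
    IsPrimitiveRoot (a : ZMod r) n := by
  have : NeZero (n : ZMod r) := ⟨by rwa [Ne, ZMod.natCast_eq_zero_iff]⟩
  rw [← isRoot_cyclotomic_prime_pow_mul_iff_of_charP (p := r) (k := k), IsRoot.def,
    ← map_cyclotomic_int, eval_intCast_map, eq_intCast, ZMod.intCast_zmod_eq_zero_iff_dvd]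
  exact h

theorem IsPrimitiveRoot.dvd_prime_sub_one {r n : ℕ} [Fact r.Prime] (hn : n ≠ 0) {a : ZMod r}
    (h : IsPrimitiveRoot a n) : n ∣ r - 1 :=
  h.dvd_of_pow_eq_one _ (ZMod.pow_card_sub_one_eq_one (h.ne_zero hn))

theorem eOrd_eq_of_isPrimitiveRoot {r m : ℕ} (hr : r ≠ 2) (hm : 0 < m) {a : ℤ}
    (h : IsPrimitiveRoot (a : ZMod r) m) : eOrd r a = m := by
  have key (j : ℕ) : (r : ℤ) ∣ a ^ j - 1 ↔ (a : ZMod r) ^ j = 1 := by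
    rw [← ZMod.intCast_zmod_eq_zero_iff_dvd]
    push_cast
    exact sub_eq_zero
  rw [eOrd_eq_iff hr a hm, key]
  refine ⟨h.pow_eq_one, fun j hj hlt => ?_⟩
  rw [key]
  exact h.pow_ne_one_of_pos_of_lt hj.ne' hlt

theorem Polynomial.eval_cyclotomic_dvd_geom_sum {r n : ℕ} (hr : r.Prime) (hn : 0 < n) (a : ℤ) :
    (cyclotomic (n * r) ℤ).eval a ∣ ∑ i ∈ Finset.range r, (a ^ n) ^ i := by
  have h : (X ^ n - 1) * cyclotomic (n * r) ℤ ∣ X ^ (n * r) - 1 :=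
    X_pow_sub_one_mul_cyclotomic_dvd_X_pow_sub_one_of_dvd ℤ
      (Nat.mem_properDivisors.2 ⟨dvd_mul_right _ _, lt_mul_of_one_lt_right hn hr.one_lt⟩)
  have h2 : (X ^ (n * r) - 1 : ℤ[X]) = (X ^ n - 1) * ∑ i ∈ Finset.range r, (X ^ n) ^ i := by
    rw [mul_geom_sum, ← pow_mul]
  rw [h2] at h
  have h3 := eval_dvd (x := a)
    ((mul_dvd_mul_iff_left (X_pow_sub_C_ne_zero hn (1 : ℤ))).1 (by simpa using h))
  simpa [eval_finsetSum] using h3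

theorem Polynomial.not_sq_dvd_eval_cyclotomic {r m : ℕ} (hr : r.Prime) (hm : 3 ≤ m)
    (hrm : r ∣ m) (a : ℤ) : ¬ (r : ℤ) ^ 2 ∣ (cyclotomic m ℤ).eval a := by
  have : Fact r.Prime := ⟨hr⟩
  intro hdvd
  obtain ⟨k, n, hrn, hkn⟩ := Nat.exists_eq_pow_mul_and_not_dvd (n := m) (by omega) r hr.ne_one
  have hprim : IsPrimitiveRoot (a : ZMod r) n := by
    apply isPrimitiveRoot_of_dvd_eval_cyclotomic (k := k) hrn
    rw [← hkn]
    exact dvd_trans (dvd_pow_self _ two_ne_zero) hdvd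
  obtain ⟨d, hd⟩ := hrm
  have hdpos : 0 < d := by
    rcases Nat.eq_zero_or_pos d with rfl | h <;> omega
  have hnd : n ∣ d := by
    have : n ∣ r * d := by rw [← hd, hkn]; exact dvd_mul_left _ _
    exact (Nat.Coprime.symm ((Nat.Prime.coprime_iff_not_dvd hr).2 hrn)).dvd_of_dvd_mul_left this
  have hone : (a : ZMod r) ^ d = 1 := (hprim.pow_eq_one_iff_dvd d).2 hnd
  have hsub : (r : ℤ) ∣ a ^ d - 1 := by
    rw [← ZMod.intCast_zmod_eq_zero_iff_dvd]
    push_cast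
    rw [hone, sub_self]
  have hsum : (r : ℤ) ^ 2 ∣ ∑ i ∈ Finset.range r, (a ^ d) ^ i := by
    refine hdvd.trans ?_
    rw [hd, mul_comm]
    exact eval_cyclotomic_dvd_geom_sum hr hdpos a
  rcases hr.eq_two_or_odd' with rfl | hodd
  · have hn1 : n = 1 := by
      have := hprim.dvd_prime_sub_one (by rintro rfl; simp at hrn)
      simpa using this
    have hdeven : Even d := by
      rw [hn1, mul_one] at hkn
      rcases k with _ | _ | k
      · omega
      · omega
      · refine ⟨2 ^ k, ?_⟩
        rw [pow_succ, pow_succ] at hkn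
        omega
    obtain ⟨e, rfl⟩ := hdeven
    simp only [Finset.sum_range_succ, Finset.sum_range_zero] at hsum
    rw [← two_mul, mul_comm, pow_mul] at hsum hsub
    have hodd : Odd (a ^ e) := by
      rw [← Int.not_even_iff_odd]
      intro he
      have := he.pow_of_ne_zero two_ne_zero
      rw [Int.even_iff] at this
      push_cast at hsub
      omega
    have := Int.sq_mod_four_eq_one_of_odd hodd
    norm_num at hsum
    omega
  · have hnot : ¬ (r : ℤ) ∣ a ^ d := by
      intro h
      have := dvd_sub h hsub
      rw [sub_sub_cancel] at this
      exact hr.one_lt.ne' (by exact_mod_cast Int.eq_one_of_dvd_one (by positivity) this)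
    have := emultiplicity_geom_sum₂_eq_one (Nat.prime_iff_prime_int.1 hr) hodd hsub hnot
    simp only [one_pow, mul_one] at this
    have h2 := le_emultiplicity_of_pow_dvd hsum
    rw [this] at h2
    exact absurd h2 (by decide)

theorem lt_abs_eval_cyclotomic_two {r m : ℕ} (hr : r.Prime) (hm : 3 ≤ m) (hrm : r ∣ m)
    (hm3 : m ≠ 3) (hm6 : m ≠ 6) {n k : ℕ} (hkn : m = r ^ k * n) (hrn : ¬ r ∣ n)
    (hn : n ∣ r - 1) {a : ℤ} (ha : |a| = 2) : (r : ℤ) < |(cyclotomic m ℤ).eval a| := by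
  obtain ⟨d, rfl⟩ := hrm
  have hd0 : d ≠ 0 := by rintro rfl; omega
  have hbound := le_abs_eval_cyclotomic hd0 (q := a ^ r)
    (by rw [abs_pow, ha]; exact one_le_pow₀ (by norm_num))
  rw [abs_pow, ha] at hbound
  have h2r : ∀ s : ℕ, 2 ≤ s → (s : ℤ) < 2 ^ s - 1 := by
    intro s hs
    induction s, hs using Nat.le_induction with
    | base => norm_num
    | succ s hs ih => push_cast; rw [pow_succ]; omega
  by_cases hrd : r ∣ d
  · have hexp := congrArg (eval a) (cyclotomic_expand_eq_cyclotomic hr hrd ℤ)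
    rw [expand_eval] at hexp
    rw [mul_comm, ← hexp]
    calc (r : ℤ) < 2 ^ r - 1 := h2r r hr.two_le
      _ ≤ (2 ^ r - 1) ^ d.totient :=
        le_self_pow₀ (by linarith [h2r r hr.two_le, hr.two_le])
          (Nat.totient_pos.2 (by omega)).ne'
      _ ≤ _ := hbound
  · have hexp := congrArg (eval a) (cyclotomic_expand_eq_cyclotomic_mul hr hrd ℤ)
    rw [expand_eval, eval_mul] at hexp
    have hnd : d = n := by
      rcases k with _ | _ | k
      · exact absurd (by rw [← one_mul n, ← pow_zero r, ← hkn]; exact dvd_mul_right _ _) hrn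
      · rw [zero_add, pow_one] at hkn
        exact Nat.eq_of_mul_eq_mul_left hr.pos hkn
      · rw [pow_succ', mul_assoc] at hkn
        have := Nat.eq_of_mul_eq_mul_left hr.pos hkn
        exact absurd (by rw [this, pow_succ', mul_assoc]; exact dvd_mul_right _ _) hrd
    subst hnd
    have hr5 : 5 ≤ r := by
      by_contra! hlt
      have := hr.two_le
      interval_cases r
      · have := Nat.le_of_dvd (by norm_num) hn
        omega
      · have := Nat.le_of_dvd (by norm_num) hn
        interval_cases d <;> omega
      · exact absurd hr (by norm_num)
    have hup := abs_eval_cyclotomic_le hd0 a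
    rw [hexp, abs_mul, mul_comm d] at hbound
    rw [ha] at hup
    norm_num at hup
    have h3r : ∀ s : ℕ, 5 ≤ s → (3 * s : ℤ) < 2 ^ s - 1 := by
      intro s hs
      induction s, hs using Nat.le_induction with
      | base => norm_num
      | succ s hs ih => push_cast; rw [pow_succ]; omega
    have hφ := (Nat.totient_pos.2 (Nat.pos_of_ne_zero hd0)).ne'
    have h1 : (3 * r : ℤ) ^ d.totient < (2 ^ r - 1) ^ d.totient :=
      pow_lt_pow_left₀ (h3r r hr5) (by positivity) hφ
    have h2 : (r : ℤ) ≤ (r : ℤ) ^ d.totient :=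
      le_self_pow₀ (by exact_mod_cast hr.one_lt.le) hφ
    rw [mul_pow] at h1
    by_contra! hle
    have h3 : |(cyclotomic (r * d) ℤ).eval a| * |(cyclotomic d ℤ).eval a|
        ≤ (r : ℤ) ^ d.totient * 3 ^ d.totient :=
      mul_le_mul (hle.trans h2) hup (abs_nonneg _) (by positivity)
    linarith

theorem lt_abs_eval_cyclotomic_of_three_le {r m : ℕ} (hr : r.Prime) (hm : 3 ≤ m) (hrm : r ∣ m)
    {a : ℤ} (ha : 3 ≤ |a|) : (r : ℤ) < |(cyclotomic m ℤ).eval a| := by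
  refine lt_of_le_of_lt ?_ (lt_abs_eval_cyclotomic hm (by linarith))
  have hle : r - 1 ≤ m.totient := by
    rw [← Nat.totient_prime hr]
    exact Nat.le_of_dvd (Nat.totient_pos.2 (by omega)) (Nat.totient_dvd_of_dvd hrm)
  have h1 : r ≤ 2 ^ (r - 1) := by
    have := Nat.lt_two_pow_self (n := r - 1)
    omega
  calc (r : ℤ) ≤ 2 ^ (r - 1) := by exact_mod_cast h1
    _ ≤ 2 ^ m.totient := pow_le_pow_right₀ (by norm_num) hle
    _ ≤ (|a| - 1) ^ m.totient := pow_le_pow_left₀ (by norm_num) (by linarith) _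

/-- If no prime divisor of `Φ_m(a)` is primitive, then `|Φ_m(a)|` is a prime divisor of `m`. -/
theorem exists_abs_eval_cyclotomic_eq_prime {a : ℤ} {m : ℕ} (ha : 1 < |a|) (hm : 3 ≤ m)
    (hemp : ¬ (Rset m a).Nonempty) : ∃ r k n : ℕ, r.Prime ∧ r ∣ m ∧ m = r ^ k * n ∧ ¬ r ∣ n ∧
      n ∣ r - 1 ∧ |(cyclotomic m ℤ).eval a| = r := by
  have hfac : ∀ r : ℕ, r.Prime → (r : ℤ) ∣ (cyclotomic m ℤ).eval a →
      r ∣ m ∧ ∃ k n, m = r ^ k * n ∧ ¬ r ∣ n ∧ n ∣ r - 1 := by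
    intro r hr hdvd
    have : Fact r.Prime := ⟨hr⟩
    obtain ⟨k, n, hrn, hkn⟩ := Nat.exists_eq_pow_mul_and_not_dvd (n := m) (by omega) r hr.ne_one
    rw [hkn] at hdvd
    have hprim := isPrimitiveRoot_of_dvd_eval_cyclotomic hrn hdvd
    have hn : n ∣ r - 1 := hprim.dvd_prime_sub_one (by rintro rfl; simp at hrn)
    refine ⟨?_, k, n, hkn, hrn, hn⟩
    by_contra hrm
    obtain rfl : k = 0 := by
      by_contra hk
      exact hrm (hkn ▸ dvd_mul_of_dvd_left (dvd_pow_self _ hk) _)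
    rw [pow_zero, one_mul] at hkn
    subst hkn
    refine hemp ⟨r, hr, eOrd_eq_of_isPrimitiveRoot ?_ (by omega) hprim⟩
    rintro rfl
    have := Nat.le_of_dvd (by norm_num) hn
    omega
  have hlt : ∀ r s : ℕ, r.Prime → s.Prime → (r : ℤ) ∣ (cyclotomic m ℤ).eval a →
      (s : ℤ) ∣ (cyclotomic m ℤ).eval a → s ≠ r → s < r := by
    intro r s hr hs hdr hds hne
    obtain ⟨-, k, n, hkn, -, hn⟩ := hfac r hr hdr
    have hsm := (hfac s hs hds).1
    rw [hkn, hs.dvd_mul] at hsm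
    have hsn := hsm.resolve_left
      fun h => hne ((Nat.prime_dvd_prime_iff_eq hs hr).1 (hs.dvd_of_dvd_pow h))
    have := Nat.le_of_dvd (Nat.sub_pos_of_lt hr.one_lt) (hsn.trans hn)
    omega
  have hgt : 1 < |(cyclotomic m ℤ).eval a| :=
    lt_of_le_of_lt (one_le_pow₀ (by linarith)) (lt_abs_eval_cyclotomic hm ha)
  set N := ((cyclotomic m ℤ).eval a).natAbs with hN
  have hNabs : |(cyclotomic m ℤ).eval a| = N := Int.abs_eq_natAbs _
  obtain ⟨r, hr, hrN⟩ := Nat.exists_prime_and_dvd (n := N) (by omega)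
  have hrN' := Int.natCast_dvd.2 hrN
  obtain ⟨hrm, k, n, hkn, hrn, hn⟩ := hfac r hr hrN'
  refine ⟨r, k, n, hr, hrm, hkn, hrn, hn, ?_⟩
  have hpow : N = r ^ N.primeFactorsList.length := by
    refine Nat.eq_prime_pow_of_unique_prime_dvd (by omega) fun {s} hs hsN => ?_
    by_contra hne
    have h1 := hlt r s hr hs hrN' (Int.natCast_dvd.2 hsN) hne
    have h2 := hlt s r hs hr (Int.natCast_dvd.2 hsN) hrN' (Ne.symm hne)
    omega
  have hsq : ¬ r ^ 2 ∣ N := by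
    intro h
    apply not_sq_dvd_eval_cyclotomic hr hm hrm a
    exact_mod_cast Int.natCast_dvd.2 h
  rw [hNabs]
  generalize N.primeFactorsList.length = l at hpow
  rcases l with _ | _ | l
  · rw [pow_zero] at hpow; omega
  · rw [hpow, zero_add, pow_one]
  · exact absurd (by rw [hpow]; exact pow_dvd_pow r (by omega)) hsq

theorem Rset_nonempty_of_three_le {a : ℤ} {m : ℕ} (ha : 1 < |a|) (hm : 3 ≤ m)
    (h26 : ¬ (a = 2 ∧ m = 6)) (h23 : ¬ (a = -2 ∧ m = 3)) : (Rset m a).Nonempty := by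
  by_contra hemp
  obtain ⟨r, k, n, hr, hrm, hkn, hrn, hn, hN⟩ := exists_abs_eval_cyclotomic_eq_prime ha hm hemp
  rcases (show 2 ≤ |a| from ha).eq_or_lt with h2 | h3
  · by_cases hm36 : m = 3 ∨ m = 6
    · have h7 : |(cyclotomic m ℤ).eval a| = 7 := by
        rcases hm36 with rfl | rfl <;> rcases eq_or_eq_neg_of_abs_eq h2.symm with rfl | rfl
        · simp [cyclotomic_three]
        · omega
        · omega
        · simp [cyclotomic_six]
      obtain rfl : r = 7 := by exact_mod_cast hN.symm.trans h7
      omega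
    · have := lt_abs_eval_cyclotomic_two hr hm hrm (by omega) (by omega) hkn hrn hn h2.symm
      omega
  · have := lt_abs_eval_cyclotomic_of_three_le hr hm hrm (show 3 ≤ |a| from h3)
    omega

theorem Rset_one_nonempty {a : ℤ} (ha : 1 < |a|) (h2 : a ≠ 2) (h3 : a ≠ 3) :
    (Rset 1 a).Nonempty := by
  by_cases h4 : (4 : ℤ) ∣ a - 1
  · exact ⟨2, Nat.prime_two, by simp [eOrd, h4]⟩
  · obtain ⟨p, hp, hp2, hdvd⟩ := Int.exists_odd_prime_dvd h4
      (by rcases lt_abs.1 ha with h | h <;> omega) (by rcases lt_abs.1 ha with h | h <;> omega)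
    refine ⟨p, hp, (eOrd_eq_iff hp2 a one_pos).2 ⟨by simpa using hdvd, fun j _ _ => by omega⟩⟩

theorem Rset_two_nonempty {a : ℤ} (ha : 1 < |a|) (h2 : a ≠ -2) (h3 : a ≠ -3) :
    (Rset 2 a).Nonempty := by
  by_cases h4 : (4 : ℤ) ∣ a + 1
  · have h4' : ¬ (4 : ℤ) ∣ a - 1 := by omega
    exact ⟨2, Nat.prime_two, by simp [eOrd, h4, h4']⟩
  · obtain ⟨p, hp, hp2, hdvd⟩ := Int.exists_odd_prime_dvd h4
      (by rcases lt_abs.1 ha with h | h <;> omega) (by rcases lt_abs.1 ha with h | h <;> omega)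
    refine ⟨p, hp, (eOrd_eq_iff hp2 a two_pos).2 ⟨?_, fun j h0 hj h => hp2 ?_⟩⟩
    · rw [show a ^ 2 - 1 = (a + 1) * (a - 1) by ring]
      exact dvd_mul_of_dvd_left hdvd _
    · obtain rfl : j = 1 := by omega
      have : (p : ℤ) ∣ 2 := by
        have := dvd_sub hdvd h
        rwa [show a + 1 - (a ^ 1 - 1) = 2 by ring] at this
      exact (Nat.prime_dvd_prime_iff_eq hp Nat.prime_two).1 (by exact_mod_cast this)

theorem Rset_not_nonempty_of_forall_prime_dvd {a : ℤ} {m : ℕ} (hm : 0 < m) (h2 : eOrd 2 a ≠ m)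
    (h : ∀ r : ℕ, r.Prime → r ≠ 2 → (r : ℤ) ∣ a ^ m - 1 →
      ∃ j, 0 < j ∧ j < m ∧ (r : ℤ) ∣ a ^ j - 1) : ¬ (Rset m a).Nonempty := by
  rintro ⟨r, hr, he⟩
  have hr2 : r ≠ 2 := by rintro rfl; exact h2 he
  obtain ⟨h1, hmin⟩ := (eOrd_eq_iff hr2 a hm).1 he
  obtain ⟨j, h0, hj, hd⟩ := h r hr hr2 h1
  exact hmin j h0 hj hd

theorem Nat.Prime.eq_of_intCast_dvd_pow {r p k : ℕ} (hr : r.Prime) (hp : p.Prime)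
    (h : (r : ℤ) ∣ (p : ℤ) ^ k) : r = p :=
  (Nat.prime_dvd_prime_iff_eq hr hp).1 (hr.dvd_of_dvd_pow (by exact_mod_cast h))

theorem bang_zsigmondy (a : ℤ) (m : ℕ) (ha : 1 < |a|) (hm : 1 ≤ m) :
    (Rset m a).Nonempty ↔
      (a, m) ∉ ({(2, 1), (2, 6), (-2, 2), (-2, 3), (3, 1), (-3, 2)} : Set (ℤ × ℕ)) := by
  simp only [Set.mem_insert_iff, Set.mem_singleton_iff, Prod.mk.injEq]
  constructor
  · intro hne hmem
    refine absurd hne (Rset_not_nonempty_of_forall_prime_dvd hm ?_ ?_)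
    · rcases hmem with ⟨rfl, rfl⟩ | ⟨rfl, rfl⟩ | ⟨rfl, rfl⟩ | ⟨rfl, rfl⟩ | ⟨rfl, rfl⟩ | ⟨rfl, rfl⟩ <;>
        norm_num [eOrd]
    · intro r hr hr2 hd
      rcases hmem with ⟨rfl, rfl⟩ | ⟨rfl, rfl⟩ | ⟨rfl, rfl⟩ | ⟨rfl, rfl⟩ | ⟨rfl, rfl⟩ | ⟨rfl, rfl⟩
      · exact absurd (hr.eq_of_intCast_dvd_pow Nat.prime_two (k := 0) (by simpa using hd)) hr2
      · rw [show (2 : ℤ) ^ 6 - 1 = (2 ^ 2 - 1) ^ 2 * (2 ^ 3 - 1) by norm_num] at hd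
        have hr' := Nat.prime_iff_prime_int.1 hr
        rcases hr'.dvd_or_dvd hd with h | h
        · exact ⟨2, by norm_num, by norm_num, hr'.dvd_of_dvd_pow h⟩
        · exact ⟨3, by norm_num, by norm_num, h⟩
      · obtain rfl := hr.eq_of_intCast_dvd_pow Nat.prime_three (k := 1) (by simpa using hd)
        exact ⟨1, by norm_num⟩
      · obtain rfl := hr.eq_of_intCast_dvd_pow Nat.prime_three (k := 2)
          (by rw [← dvd_neg]; simpa using hd)
        exact ⟨1, by norm_num⟩
      · exact absurd (hr.eq_of_intCast_dvd_pow Nat.prime_two (k := 1) (by simpa using hd)) hr2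
      · exact absurd (hr.eq_of_intCast_dvd_pow Nat.prime_two (k := 3) (by simpa using hd)) hr2
  · intro hmem
    obtain rfl | rfl | h3 : m = 1 ∨ m = 2 ∨ 3 ≤ m := by omega
    · exact Rset_one_nonempty ha (by omega) (by omega)
    · exact Rset_two_nonempty ha (by omega) (by omega)
    · exact Rset_nonempty_of_three_le ha h3 (by omega) (by omega)
end

section
/- Suppose G is a finite group and K is a normal subgroup of G that is a w-group for some prime w (i.e., |K| is a power of w). Suppose G/K is a Frobenius group with kernel F and cyclic complement C; explicitly: F is a normal subgroup of G/K, C is a cyclic subgroup of G/K, F ∩ C = 1, F·C = G/K, and for all nontrivial c ∈ C and nontrivial f ∈ F one has c·f·c⁻¹ ≠ f. If gcd(|F|, w) = 1 and F is not contained in the image of K·C_G(K) in G/K, then G contains an element of order w·|C|. -/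
/-- In a coprime action of a Frobenius group on an abelian group, a complement whose norm map
vanishes forces the kernel to act trivially. -/
theorem act_trivially_of_complement_norm_eq_one {Q V : Type*} [Group Q] [CommGroup V]
    (φ : Q →* MulAut V) (F C : Subgroup Q) [hF : F.Normal] [Fintype F] [Fintype C]
    (hfrob : ∀ c ∈ C, c ≠ 1 → ∀ f ∈ F, f ≠ 1 → c * f * c⁻¹ ≠ f)
    {w : ℕ} (hcop : (Fintype.card F).Coprime w) (hexp : ∀ v : V, v ^ w = 1)
    (hnorm : ∀ v : V, ∏ c : C, φ c v = 1) {f : Q} (hf : f ∈ F) (v : V) : φ f v = v := by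
  classical
  have key : ∀ v : V, ∏ g : F, φ g v = v ^ Fintype.card F := by
    intro v
    have h1 : ∏ g : F, ∏ c : C, φ (g * c * (g : Q)⁻¹) v = 1 := by
      refine Finset.prod_eq_one fun g _ => ?_
      have : ∀ c : C, φ (g * c * (g : Q)⁻¹) v = φ g (φ c (φ (g : Q)⁻¹ v)) := by
        intro c; simp [map_mul, MulAut.mul_apply]
      simp_rw [this]
      rw [← map_prod, hnorm, map_one]
    rw [Finset.prod_comm, ← Finset.mul_prod_erase _ _ (Finset.mem_univ (1 : C))] at h1
    have h2 : ∏ c : C, ∏ g : F, φ g (φ c v) = 1 := by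
      rw [Finset.prod_comm]
      refine Finset.prod_eq_one fun g _ => ?_
      rw [← map_prod, hnorm, map_one]
    rw [← Finset.mul_prod_erase _ _ (Finset.mem_univ (1 : C)), ← h1] at h2
    have h3 : ∀ c ∈ Finset.univ.erase (1 : C),
        ∏ g : F, φ (g * c * (g : Q)⁻¹) v = ∏ g : F, φ g (φ c v) := by
      intro c hc
      have hc1 : (c : Q) ≠ 1 := fun h => Finset.ne_of_mem_erase hc (Subtype.ext h)
      let e : F → F := fun g => ⟨g * (c * (g : Q)⁻¹ * (c : Q)⁻¹),
        F.mul_mem g.2 (hF.conj_mem _ (F.inv_mem g.2) _)⟩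
      have he : Function.Injective e := by
        intro a b hab
        have hab' : (a : Q) * (c * (a : Q)⁻¹ * (c : Q)⁻¹) = b * (c * (b : Q)⁻¹ * (c : Q)⁻¹) :=
          congrArg Subtype.val hab
        by_contra hne
        refine hfrob c c.2 hc1 ((b : Q)⁻¹ * a) (F.mul_mem (F.inv_mem b.2) a.2) ?_ ?_
        · intro h
          exact hne (Subtype.ext (inv_mul_eq_one.mp h).symm)
        · have : (c : Q) * ((b : Q)⁻¹ * a) * (c : Q)⁻¹ =
              (b : Q)⁻¹ * (b * (c * (b : Q)⁻¹ * (c : Q)⁻¹)) * (c * a * (c : Q)⁻¹) := by group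
          rw [this, ← hab']; group
      refine Fintype.prod_bijective e (Finite.injective_iff_bijective.mp he) _ _ fun g => ?_
      rw [← MulAut.mul_apply, ← map_mul]
      congr 2
      simp [e, mul_assoc]
    rw [Finset.prod_congr rfl h3] at h2
    simpa using mul_right_cancel h2
  have hpow : (φ f v) ^ Fintype.card F = v ^ Fintype.card F := by
    rw [← map_pow, ← key, map_prod]
    refine Fintype.prod_equiv (Equiv.mulLeft ⟨f, hf⟩) _ _ fun g => ?_
    simp [map_mul, MulAut.mul_apply]
  have hd : (φ f v * v⁻¹) ^ Fintype.card F = 1 := by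
    rw [mul_pow, hpow, inv_pow, mul_inv_cancel]
  have ho : orderOf (φ f v * v⁻¹) = 1 :=
    Nat.eq_one_of_dvd_coprimes hcop (orderOf_dvd_of_pow_eq_one hd)
      (orderOf_dvd_of_pow_eq_one (hexp _))
  exact mul_inv_eq_one.mp (orderOf_eq_one_iff.mp ho)

/-- If the kernel of a surjection onto a group containing a Frobenius subgroup with cyclic
complement `C` is elementary abelian and not centralized by the preimage of the Frobenius kernel, then the
source has an element of order `w * |C|`. -/
theorem exists_orderOf_of_ker_elementary {G Q : Type*} [Group G] [Finite G] [Group Q]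
    (π : G →* Q) (hπ : Function.Surjective π) (F C : Subgroup Q) [hF : F.Normal] [IsCyclic C]
    (hfrob : ∀ c ∈ C, c ≠ 1 → ∀ f ∈ F, f ≠ 1 → c * f * c⁻¹ ≠ f)
    {w : ℕ} (hw : w.Prime) (hcop : (Nat.card F).Coprime w)
    (hcomm : ∀ x ∈ π.ker, ∀ y ∈ π.ker, x * y = y * x) (hexp : ∀ x ∈ π.ker, x ^ w = 1)
    {g : G} (hg : π g ∈ F) {x : G} (hx : x ∈ π.ker) (hgx : g * x ≠ x * g) :
    ∃ y : G, orderOf y = w * Nat.card C := by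
  classical
  have : Finite Q := Finite.of_surjective π hπ
  have := Fintype.ofFinite F
  have := Fintype.ofFinite C
  let : CommGroup π.ker :=
    { (inferInstance : Group π.ker) with
      mul_comm := fun a b => Subtype.ext (hcomm a a.2 b b.2) }
  let φ : Q →* MulAut π.ker := π.liftOfRightInverse _ (Function.rightInverse_surjInv hπ)
    ⟨MulAut.conjNormal, fun a ha => by
      rw [MonoidHom.mem_ker]
      ext b
      rw [MulAut.conjNormal_apply, hcomm a ha b b.2]
      simp⟩
  have hφ : ∀ (a : G) (b : π.ker), (φ (π a) b : G) = a * b * a⁻¹ := by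
    intro a b
    have : φ (π a) = MulAut.conjNormal a :=
      π.liftOfRightInverse_comp_apply _ (Function.rightInverse_surjInv hπ) _ a
    rw [this, MulAut.conjNormal_apply]
  obtain ⟨c, hc⟩ := IsCyclic.exists_generator (α := C)
  obtain ⟨t, ht⟩ := hπ c
  have hoc : orderOf (c : Q) = Nat.card C := by
    rw [Subgroup.orderOf_coe, orderOf_eq_card_of_forall_mem_zpowers hc]
  have hprod : ∀ (v : π.ker) (n : ℕ), ((v : G) * t) ^ n =
      ((∏ i ∈ Finset.range n, φ ((c : Q) ^ i) v : π.ker) : G) * t ^ n := by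
    intro v n
    induction n with
    | zero => simp
    | succ n ih =>
      rw [pow_succ, ih, Finset.prod_range_succ, Subgroup.coe_mul, ← ht, ← map_pow, hφ]
      group
  have hker : ∀ v : π.ker, π (v * t) = c := fun v => by
    rw [map_mul, v.2, one_mul, ht]
  have hex : ∃ v : π.ker, ((v : G) * t) ^ Nat.card C ≠ 1 := by
    by_contra! hall
    have ht1 : t ^ Nat.card C = 1 := by simpa using hall 1
    refine hgx ?_
    have hnorm : ∀ v : π.ker, ∏ d : C, φ d v = 1 := by
      intro v
      have h := hall v
      rw [hprod, ht1, mul_one, OneMemClass.coe_eq_one] at h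
      rw [← h, ← IsCyclic.image_range_card hc, Finset.prod_image]
      · simp
      · intro i hi j hj hij
        rw [Finset.coe_range, ← orderOf_eq_card_of_forall_mem_zpowers hc] at hi hj
        exact pow_injOn_Iio_orderOf hi hj hij
    have := act_trivially_of_complement_norm_eq_one φ F C hfrob
      (by rwa [← Nat.card_eq_fintype_card]) (fun v => Subtype.ext (by simpa using hexp v v.2))
      hnorm hg ⟨x, hx⟩
    have h := congrArg Subtype.val this
    rw [hφ] at h
    exact mul_inv_eq_iff_eq_mul.mp h
  obtain ⟨v, hv⟩ := hex
  refine ⟨v * t, ?_⟩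
  have hdvd : Nat.card C ∣ orderOf ((v : G) * t) := by
    rw [← hoc, ← hker v]
    exact orderOf_map_dvd π _
  have hpos : Nat.card C ≠ 0 := Nat.card_pos.ne'
  have hmem : ((v : G) * t) ^ Nat.card C ∈ π.ker := by
    rw [MonoidHom.mem_ker, map_pow, hker, ← hoc, pow_orderOf_eq_one]
  have := Fact.mk hw
  have ho := orderOf_eq_prime (hexp _ hmem) hv
  rw [orderOf_pow_of_dvd hpos hdvd] at ho
  rw [← ho, Nat.div_mul_cancel hdvd]

/-- The quotient of a finite `p`-group by its Frattini subgroup is elementary abelian. -/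
theorem frattini_quotient_elementary {P : Type*} [Group P] [Finite P] {p : ℕ} [hp : Fact p.Prime]
    (hP : IsPGroup p P) :
    (∀ x y : P, x * y * x⁻¹ * y⁻¹ ∈ frattini P) ∧ ∀ x : P, x ^ p ∈ frattini P := by
  have hmax : ∀ M : Subgroup P, IsCoatom M →
      (∀ x y : P, x * y * x⁻¹ * y⁻¹ ∈ M) ∧ ∀ x : P, x ^ p ∈ M := by
    intro M hM
    have := hP.isNilpotent
    have hn : M.Normal :=
      Subgroup.NormalizerCondition.normal_of_coatom M Group.normalizerCondition_of_isNilpotent hM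
    have hcard : Nat.card (P ⧸ M) = p := by
      obtain ⟨n, hn⟩ := IsPGroup.iff_card.mp (hP.to_subgroup M)
      obtain ⟨k, hk⟩ := hP.exists_card_eq
      have hlt : n < k := by
        rw [← Nat.pow_lt_pow_iff_right hp.out.one_lt, ← hn, ← hk]
        refine lt_of_le_of_ne (Subgroup.card_le_card_group M) fun h => ?_
        exact hM.1 (Subgroup.eq_top_of_card_eq M h)
      obtain ⟨H, hH, hMH⟩ := Sylow.exists_subgroup_card_pow_succ
        (hk ▸ pow_dvd_pow p (Nat.succ_le_of_lt hlt)) hn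
      have hne : M ≠ H := by
        rintro rfl
        rw [hn] at hH
        exact absurd (Nat.pow_right_injective hp.out.two_le hH) (by simp)
      have hmul := M.card_mul_index
      have hHtop : Nat.card P = p ^ (n + 1) := by
        rw [← hH, hM.2 H (lt_of_le_of_ne hMH hne), Subgroup.card_top]
      rw [hHtop, hn, pow_succ] at hmul
      exact Nat.eq_of_mul_eq_mul_left (pow_pos hp.out.pos n) hmul
    have hcyc : IsCyclic (P ⧸ M) := isCyclic_of_prime_card hcard
    have hcm := hcyc.isMulCommutative
    constructor
    · intro x y
      rw [← QuotientGroup.eq_one_iff]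
      simp only [QuotientGroup.mk_mul, QuotientGroup.mk_inv]
      rw [mul_comm' (x : P ⧸ M) y, mul_inv_cancel_right, mul_inv_cancel]
    · intro x
      rw [← QuotientGroup.eq_one_iff, QuotientGroup.mk_pow, ← hcard, pow_card_eq_one']
  simp only [frattini, Order.radical, Subgroup.mem_iInf]
  exact ⟨fun x y M hM => (hmax M hM).1 x y, fun x M hM => (hmax M hM).2 x⟩

/-- A prime power order automorphism, of order prime to `p`, of a finite `p`-group
that is trivial modulo the Frattini subgroup is trivial. -/
theorem eq_one_of_act_trivially_mod_frattini {P : Type*} [Group P] [Finite P] {p q k : ℕ}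
    [hp : Fact p.Prime] [hq : Fact q.Prime] (hpq : p ≠ q) (hP : IsPGroup p P)
    {σ : MulAut P} (hσ : σ ^ q ^ k = 1) (htriv : ∀ x, x⁻¹ * σ x ∈ frattini P) : σ = 1 := by
  classical
  let H : Subgroup P := (σ : P →* P).eqLocus (MonoidHom.id P)
  suffices H ⊔ frattini P = ⊤ by
    have hH : H = ⊤ := frattini_nongenerating this
    ext x
    have : x ∈ H := hH ▸ Subgroup.mem_top x
    exact this
  rw [eq_top_iff]
  intro x _
  let X := {y : P // x⁻¹ * y ∈ frattini P}
  let f : Function.End X := fun y => ⟨σ y, by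
    have := mul_mem y.2 (htriv y)
    simpa [mul_assoc] using this⟩
  have hfn : ∀ (n : ℕ) (y : X), ((f ^ n) y : P) = (σ ^ n) y := by
    intro n
    induction n with
    | zero => intro y; rfl
    | succ n ih => intro y; rw [pow_succ, pow_succ, MulAut.mul_apply]; exact ih (f y)
  have hf : f ^ q ^ k = 1 := by
    funext y
    apply Subtype.ext
    rw [hfn, hσ]; rfl
  have := Fintype.ofFinite X
  have hmod := Equiv.Perm.card_fixedPoints_modEq hf
  have hX : Nat.card X = Nat.card (frattini P) := by
    exact Nat.card_congr ⟨fun y => ⟨_, y.2⟩, fun z => ⟨x * z, by simp⟩, fun y => by simp,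
      fun z => by simp⟩
  have hne : Nonempty f.fixedPoints := by
    by_contra hemp
    rw [not_nonempty_iff] at hemp
    rw [Fintype.card_eq_zero (α := f.fixedPoints), Nat.modEq_zero_iff_dvd,
      ← Nat.card_eq_fintype_card, hX] at hmod
    obtain ⟨n, hn⟩ := IsPGroup.iff_card.mp (hP.to_subgroup (frattini P))
    rw [hn] at hmod
    exact hpq ((Nat.prime_dvd_prime_iff_eq hq.out hp.out).mp (hq.out.dvd_of_dvd_pow hmod)).symm
  obtain ⟨y, hy⟩ := hne
  have hyH : (y : P) ∈ H := congrArg Subtype.val hy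
  have : x = y * (x⁻¹ * (y : P))⁻¹ := by group
  rw [this]
  exact mul_mem (Subgroup.mem_sup_left hyH) (Subgroup.mem_sup_right (inv_mem y.2))

/-- A subgroup containing all elements of prime power order of `N` contains `N`. -/
theorem mem_of_primePow_orderOf_mem {G : Type*} [Group G] [Finite G] {N L : Subgroup G}
    (h : ∀ g ∈ N, ∀ p k : ℕ, p.Prime → orderOf g = p ^ k → g ∈ L) {g : G} (hg : g ∈ N) :
    g ∈ L := by
  suffices ∀ n : ℕ, ∀ g ∈ N, orderOf g = n → g ∈ L from this _ g hg rfl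
  intro n
  induction n using Nat.recOnPosPrimePosCoprime with
  | prime_pow p k hp _ => exact fun g hg hgn => h g hg p k hp hgn
  | zero => exact fun g _ hgn => absurd hgn (orderOf_pos g).ne'
  | one => exact fun g _ hgn => orderOf_eq_one_iff.mp hgn ▸ L.one_mem
  | coprime a b ha hb hab iha ihb =>
    intro g hg hgn
    have ha' : g ^ b ∈ L := iha _ (N.pow_mem hg b) (by
      rw [orderOf_pow_of_dvd (by lia) (hgn ▸ dvd_mul_left b a), hgn,
        Nat.mul_div_cancel _ (by lia)])
    have hb' : g ^ a ∈ L := ihb _ (N.pow_mem hg a) (by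
      rw [orderOf_pow_of_dvd (by lia) (hgn ▸ dvd_mul_right a b), hgn,
        Nat.mul_div_cancel_left _ (by lia)])
    have hbez := Nat.gcd_eq_gcd_ab a b
    rw [hab] at hbez
    have : g = (g ^ a) ^ Nat.gcdA a b * (g ^ b) ^ Nat.gcdB a b := by
      rw [← zpow_natCast, ← zpow_natCast, ← zpow_mul, ← zpow_mul, ← zpow_add, ← hbez]
      simp
    rw [this]
    exact L.mul_mem (L.zpow_mem hb' _) (L.zpow_mem ha' _)

theorem exists_order_of_frobenius_quotient
    (G : Type*) [Group G] [Finite G] (K : Subgroup G) (hKn : K.Normal)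
    (w : ℕ) (hw : w.Prime) (hKw : ∃ n : ℕ, Nat.card K = w ^ n)
    (F C : Subgroup (G ⧸ K)) (hFn : F.Normal) (hC : IsCyclic C)
    (hFC1 : F ⊓ C = ⊥)
    (hFC : ∀ x : G ⧸ K, ∃ f ∈ F, ∃ c ∈ C, x = f * c)
    (hfrob : ∀ c ∈ C, c ≠ 1 → ∀ f ∈ F, f ≠ 1 → c * f * c⁻¹ ≠ f)
    (hcop : Nat.gcd (Nat.card F) w = 1)
    (hnotle : ¬ F ≤ Subgroup.map (QuotientGroup.mk' K) (K ⊔ Subgroup.centralizer (K : Set G))) :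
    ∃ g : G, orderOf g = w * Nat.card C := by
  have := Fact.mk hw
  have hKp : IsPGroup w K := IsPGroup.iff_card.mpr hKw
  obtain ⟨g, q, k, hq, hqw, hgq, hgF, hgL⟩ : ∃ (g : G) (q k : ℕ), q.Prime ∧ q ≠ w ∧
      g ^ q ^ k = 1 ∧ (g : G ⧸ K) ∈ F ∧ g ∉ Subgroup.centralizer (K : Set G) := by
    by_contra! hall
    refine hnotle fun f hf => ?_
    obtain ⟨g, rfl⟩ := QuotientGroup.mk_surjective f
    refine ⟨g, ?_, rfl⟩
    refine mem_of_primePow_orderOf_mem (N := F.comap (QuotientGroup.mk' K)) ?_ hf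
    intro g hg p k hp hgk
    by_cases hpw : p = w
    · subst hpw
      refine Subgroup.mem_sup_left ((QuotientGroup.eq_one_iff g).mp (orderOf_eq_one_iff.mp ?_))
      refine Nat.eq_one_of_dvd_coprimes (Nat.Coprime.pow_right k hcop)
        (Subgroup.orderOf_dvd_natCard F hg) (orderOf_dvd_of_pow_eq_one ?_)
      rw [← QuotientGroup.mk_pow, ← hgk, pow_orderOf_eq_one, QuotientGroup.mk_one]
    · exact Subgroup.mem_sup_right (hall g p k hp hpw (hgk ▸ pow_orderOf_eq_one g) hg)
  have := Fact.mk hq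
  obtain ⟨x, hx⟩ : ∃ x : K, x⁻¹ * MulAut.conjNormal g x ∉ frattini K := by
    by_contra! hall
    have hσ := eq_one_of_act_trivially_mod_frattini (k := k) hqw.symm hKp
      (by rw [← map_pow, hgq, map_one]) hall
    refine hgL (Subgroup.mem_centralizer_iff.mpr fun x hx => ?_)
    have h := congrArg Subtype.val (DFunLike.congr_fun hσ (⟨x, hx⟩ : K))
    rw [MulAut.conjNormal_apply] at h
    exact (mul_inv_eq_iff_eq_mul.mp h).symm
  obtain ⟨hcomm, hpow⟩ := frattini_quotient_elementary hKp
  have : (frattini K).Characteristic := frattini_characteristic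
  let U : Subgroup G := (frattini K).map K.subtype
  have hU : ∀ z : K, (z : G) ∈ U ↔ z ∈ frattini K := fun z =>
    Subgroup.mem_map_iff_mem K.subtype_injective
  have hUK : U ≤ K := Subgroup.map_subtype_le _
  have : U.Normal := inferInstance
  let π : G ⧸ U →* G ⧸ K := QuotientGroup.map U K (MonoidHom.id G) hUK
  have hker : ∀ a ∈ π.ker, ∃ b : K, ((b : G) : G ⧸ U) = a := by
    intro a ha
    obtain ⟨b, rfl⟩ := QuotientGroup.mk_surjective a
    exact ⟨⟨b, (QuotientGroup.eq_one_iff b).mp ha⟩, rfl⟩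
  obtain ⟨y, hy⟩ := exists_orderOf_of_ker_elementary π
    (fun a => by
      obtain ⟨b, rfl⟩ := QuotientGroup.mk_surjective a
      exact ⟨b, rfl⟩)
    F C hfrob hw hcop
    (by
      intro a ha b hb
      obtain ⟨a, rfl⟩ := hker a ha
      obtain ⟨b, rfl⟩ := hker b hb
      rw [← QuotientGroup.mk_mul, ← QuotientGroup.mk_mul, QuotientGroup.eq]
      have := (hU _).mpr (hcomm b⁻¹ a⁻¹)
      simpa [mul_assoc] using this)
    (by
      intro a ha
      obtain ⟨a, rfl⟩ := hker a ha
      rw [← QuotientGroup.mk_pow, QuotientGroup.eq_one_iff]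
      exact (hU (a ^ w)).mpr (hpow a))
    (g := (g : G ⧸ U)) hgF (x := ((x : G) : G ⧸ U)) ((QuotientGroup.eq_one_iff (x : G)).mpr x.2)
    (by
      intro h
      have h' : ((x : G) : G ⧸ U) = ((g * x * g⁻¹ : G) : G ⧸ U) := by
        rw [QuotientGroup.mk_mul, QuotientGroup.mk_mul, h]
        simp
      rw [QuotientGroup.eq] at h'
      exact hx ((hU _).mp (by simpa using h')))
  obtain ⟨z, rfl⟩ := QuotientGroup.mk_surjective y
  have hdvd : orderOf (z : G ⧸ U) ∣ orderOf z := orderOf_map_dvd (QuotientGroup.mk' U) z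
  rw [hy] at hdvd
  exact ⟨_, orderOf_pow_orderOf_div (orderOf_pos z).ne' hdvd⟩
end

section
/- Let v and r be distinct primes and let G be a semidirect product of a finite v-group U (|U| a power of v) and a cyclic group ⟨g⟩ of order r. Suppose that the commutator subgroup [U, g] is nontrivial and that G acts faithfully and linearly on a vector space W over a field of prime characteristic w with w ≠ v. Then either the natural semidirect product W ⋊ G has an element of order r·w (equivalently, some element of order r in G has a nonzero fixed vector in W), or all of the following hold: (1) the centralizer C_U(g) is nontrivial; (2) U is nonabelian; (3) v = 2 and r is a Fermat prime, i.e., r = 2^(2^k) + 1 for some nonnegative integer k. -/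
theorem Module.Basis.card_le_finrank_centralizer {K S I : Type*} [Field K] [Fintype I]
    [DecidableEq K] [AddCommGroup S] [Module K S] [FiniteDimensional K S]
    (v : Module.Basis I K S) (f : Module.End K S) (μ : I → K) (hfv : ∀ i, f (v i) = μ i • v i) :
    Fintype.card {x : I × I // μ x.1 = μ x.2} ≤
      Module.finrank K (Subalgebra.centralizer K {f}) := by
  classical
  have hE (i j k : I) : Matrix.toLin v v (Matrix.single i j 1) (v k) =
      if j = k then v i else 0 := by
    rw [Matrix.toLin_self]
    by_cases h : j = k <;> simp [Matrix.single_apply, h, ite_smul]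
  let E : {x : I × I // μ x.1 = μ x.2} → Subalgebra.centralizer K {f} := fun x ↦
    ⟨Matrix.toLin v v (Matrix.single x.1.1 x.1.2 1), by
      rw [Subalgebra.mem_centralizer_iff]
      rintro _ rfl
      refine v.ext fun k ↦ ?_
      rw [Module.End.mul_apply, Module.End.mul_apply, hfv, map_smul, hE]
      split_ifs with h
      · rw [hfv, ← h, x.2]
      · simp⟩
  have hlin : LinearIndependent K E := by
    refine LinearIndependent.of_comp
      ((Matrix.toLin v v).symm.toLinearMap ∘ₗ (Subalgebra.centralizer K {f}).val.toLinearMap) ?_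
    convert (Matrix.stdBasis K I I).linearIndependent.comp
      (fun x : {x : I × I // μ x.1 = μ x.2} ↦ x.1) Subtype.val_injective using 1
    funext x
    simp only [Function.comp_apply]
    rw [Matrix.stdBasis_eq_single]
    exact (Matrix.toLin v v).symm_apply_apply _
  exact hlin.fintype_card_le_finrank

theorem Module.End.sq_finrank_le_natDegree_mul_finrank_centralizer {K S : Type*} [Field K]
    [IsAlgClosed K] [AddCommGroup S] [Module K S] [FiniteDimensional K S] (f : Module.End K S)
    (p : Polynomial K) (hp : p.Separable) (hf : Polynomial.aeval f p = 0) :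
    Module.finrank K S ^ 2 ≤
      p.natDegree * Module.finrank K (Subalgebra.centralizer K {f}) := by
  classical
  have hss : f.IsSemisimple := Module.End.isSemisimple_of_squarefree_aeval_eq_zero hp.squarefree hf
  let D := DirectSum.isInternal_submodule_of_iSupIndep_of_iSup_eq_top
    f.eigenspaces_iSupIndep hss.iSup_eigenspace_eq_top
  let I := (ν : K) × Fin (Module.finrank K (f.eigenspace ν))
  let v : Module.Basis I K S := D.collectedBasis fun μ ↦ Module.finBasis K (f.eigenspace μ)
  have : Fintype I := FiniteDimensional.fintypeBasisIndex v
  let μ : I → K := Sigma.fst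
  have hfv (i : I) : f (v i) = μ i • v i :=
    Module.End.mem_eigenspace_iff.mp (D.collectedBasis_mem _ i)
  have hroot : Finset.univ.image μ ⊆ p.roots.toFinset := by
    intro c hc
    obtain ⟨i, -, rfl⟩ := Finset.mem_image.mp hc
    rw [Multiset.mem_toFinset, Polynomial.mem_roots hp.ne_zero]
    have h := Module.End.aeval_apply_of_hasEigenvector (p := p)
      ⟨Module.End.mem_eigenspace_iff.mpr (hfv i), v.ne_zero i⟩
    rw [hf, LinearMap.zero_apply, eq_comm, smul_eq_zero] at h
    exact h.resolve_right (v.ne_zero i)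
  have hcard : (Finset.univ.image μ).card ≤ p.natDegree :=
    (Finset.card_le_card hroot).trans
      ((Multiset.toFinset_card_le _).trans (Polynomial.card_roots' p))
  have hJ : Fintype.card {x : I × I // μ x.1 = μ x.2} =
      ∑ c ∈ Finset.univ.image μ, (Finset.univ.filter (μ · = c)).card ^ 2 := by
    rw [Fintype.card_subtype, Finset.card_eq_sum_card_fiberwise
      (f := fun x : I × I ↦ μ x.1) (t := Finset.univ.image μ) (by intro x _; simp)]
    refine Finset.sum_congr rfl fun c _ ↦ ?_
    rw [sq, ← Finset.card_product]
    congr 1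
    ext x
    simp only [Finset.mem_filter, Finset.mem_univ, true_and, Finset.mem_product]
    grind
  have hS : Module.finrank K S =
      ∑ c ∈ Finset.univ.image μ, (Finset.univ.filter (μ · = c)).card := by
    rw [Module.finrank_eq_card_basis v, ← Finset.card_univ, Finset.card_eq_sum_card_image μ]
  calc Module.finrank K S ^ 2
      ≤ (Finset.univ.image μ).card * Fintype.card {x : I × I // μ x.1 = μ x.2} := by
        rw [hS, hJ]; exact_mod_cast sq_sum_le_card_mul_sum_sq
    _ ≤ _ := Nat.mul_le_mul hcard (v.card_le_finrank_centralizer f μ hfv)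

theorem IsSimpleRing.exists_finrank_eq_sq_le_mul_finrank_centralizer {K A : Type*} [Field K]
    [IsAlgClosed K] [Ring A] [Algebra K A] [IsSimpleRing A] [FiniteDimensional K A]
    {r : ℕ} (hr : (r : K) ≠ 0) (u : A) (hu : ∑ i ∈ Finset.range r, u ^ i = 0) :
    ∃ n : ℕ, Module.finrank K A = n ^ 2 ∧
      n ^ 2 ≤ (r - 1) * Module.finrank K (Subalgebra.centralizer K {u}) := by
  obtain ⟨n, -, ⟨e₀⟩⟩ := IsSimpleRing.exists_algEquiv_matrix_of_isAlgClosed K A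
  let e : A ≃ₐ[K] Module.End K (Fin n → K) := e₀.trans Matrix.toLinAlgEquiv'
  refine ⟨n, by rw [e₀.toLinearEquiv.finrank_eq, Module.finrank_matrix]; simp [sq], ?_⟩
  let p : Polynomial K := ∑ i ∈ Finset.range r, Polynomial.X ^ i
  have hp : p.Separable := by
    refine Polynomial.Separable.of_mul_left (g := Polynomial.X - 1) ?_
    rw [geom_sum_mul, ← Polynomial.C_1]
    exact Polynomial.separable_X_pow_sub_C 1 hr one_ne_zero
  have hdeg : p.natDegree ≤ r - 1 := by
    refine Polynomial.natDegree_sum_le_of_forall_le _ _ fun i hi ↦ ?_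
    have := Finset.mem_range.mp hi
    simp only [Polynomial.natDegree_X_pow]
    omega
  have hroot : Polynomial.aeval (e u) p = 0 := by
    have h := congrArg e hu
    simpa [p] using h
  have h := (e u).sq_finrank_le_natDegree_mul_finrank_centralizer p hp hroot
  rw [Module.finrank_fin_fun] at h
  refine h.trans (Nat.mul_le_mul hdeg ?_)
  let φ : Subalgebra.centralizer K {e u} →ₗ[K] Subalgebra.centralizer K {u} :=
    (e.symm.toLinearMap ∘ₗ (Subalgebra.centralizer K {e u}).val.toLinearMap).codRestrict
      (Subalgebra.toSubmodule (Subalgebra.centralizer K {u})) fun a ↦ by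
        rw [Subalgebra.mem_toSubmodule, Subalgebra.mem_centralizer_iff]
        rintro x (rfl : x = u)
        apply e.injective
        simpa using (Subalgebra.mem_centralizer_iff K).mp a.2 _ rfl
  refine LinearMap.finrank_le_finrank_of_injective (f := φ) fun a b hab ↦ ?_
  exact Subtype.ext (e.symm.injective (congrArg Subtype.val hab))

theorem Module.End.exists_eq_smul_of_pow_eq_smul {K V : Type*} [Field K] [IsAlgClosed K]
    [AddCommGroup V] [Module K V] [Nontrivial V] (f : Module.End K V) {k : ℕ} (hk : 0 < k) (s : K)
    (hf : f ^ k = s • 1) : ∃ c : K, ∃ v : V, v ≠ 0 ∧ f v = c • v := by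
  by_contra! h
  have hinj : ∀ t : Multiset K, ∀ v : V, v ≠ 0 →
      Polynomial.aeval f (t.map fun c ↦ Polynomial.X - Polynomial.C c).prod v ≠ 0 := by
    intro t
    induction t using Multiset.induction_on with
    | empty => simp
    | cons c t ih =>
      intro v hv h0
      rw [Multiset.map_cons, Multiset.prod_cons, map_mul, Module.End.mul_apply] at h0
      refine h c _ (ih v hv) ?_
      simpa [sub_eq_zero, Module.algebraMap_end_apply] using h0
  obtain ⟨v, hv⟩ := exists_ne (0 : V)
  have hmonic := Polynomial.monic_X_pow_sub_C s hk.ne'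
  refine hinj (Polynomial.X ^ k - Polynomial.C s).roots v hv ?_
  rw [← (IsAlgClosed.splits _).eq_prod_roots_of_monic hmonic]
  simp [hf, Module.algebraMap_end_apply]

theorem map_mul_map_inv {Q B : Type*} [Group Q] [Ring B] (τ : Q →* B) (q : Q) :
    τ q * τ q⁻¹ = 1 := by
  rw [← map_mul, mul_inv_cancel, map_one]

theorem map_inv_mul_map {Q B : Type*} [Group Q] [Ring B] (τ : Q →* B) (q : Q) :
    τ q⁻¹ * τ q = 1 := by
  rw [← map_mul, inv_mul_cancel, map_one]

/-- The operator `b ↦ ∑ q, τ q * b * τ q⁻¹`, an unnormalized projection onto the centralizer of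
`τ`. -/
noncomputable def conjSum (K : Type*) {Q B : Type*} [Field K] [Group Q] [Fintype Q] [Ring B]
    [Algebra K B] (τ : Q →* B) : B →ₗ[K] B :=
  ∑ q, LinearMap.mulLeftRight K (τ q, τ q⁻¹)

/-- `τ` sends `Z` to scalars, while averaging over conjugation kills every `τ x` with `x ∉ Z`. For
an irreducible representation this says that its character vanishes off `Z`. -/
structure IsFullyRamified (K : Type*) {Q B : Type*} [Field K] [Group Q] [Fintype Q] [Ring B]
    [Algebra K B] (τ : Q →* B) (Z : Subgroup Q) : Prop where
  card_ne_zero : (Fintype.card Q : K) ≠ 0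
  exists_algebraMap : ∀ z ∈ Z, ∃ c : K, τ z = algebraMap K B c
  conjSum_eq_zero : ∀ x ∉ Z, conjSum K τ (τ x) = 0

section FullyRamified

variable {K Q B : Type*} [Field K] [Group Q] [Fintype Q] [Ring B] [Algebra K B]

theorem conjSum_apply (τ : Q →* B) (b : B) :
    conjSum K τ b = ∑ q, τ q * b * τ q⁻¹ := by
  simp [conjSum, LinearMap.sum_apply]

theorem conjSum_eq_smul_of_commute (τ : Q →* B) {b : B} (hb : ∀ q, τ q * b = b * τ q) :
    conjSum K τ b = (Fintype.card Q : K) • b := by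
  simp [conjSum_apply, hb, mul_assoc, map_mul_map_inv, ← Nat.cast_smul_eq_nsmul K]

namespace IsFullyRamified

variable {τ : Q →* B} {Z : Subgroup Q}

theorem conjSum_map_of_mem (h : IsFullyRamified K τ Z) {z : Q} (hz : z ∈ Z) :
    conjSum K τ (τ z) = (Fintype.card Q : K) • τ z := by
  obtain ⟨c, hc⟩ := h.exists_algebraMap z hz
  refine conjSum_eq_smul_of_commute τ fun q ↦ ?_
  rw [hc, Algebra.commutes]

theorem exists_conjSum_eq (h : IsFullyRamified K τ Z)
    {b : B} (hb : b ∈ Submodule.span K (Set.range τ)) :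
    ∃ c : K, conjSum K τ b = algebraMap K B c := by
  suffices conjSum K τ b ∈ Subalgebra.toSubmodule (⊥ : Subalgebra K B) by
    obtain ⟨c, hc⟩ := Algebra.mem_bot.mp this
    exact ⟨c, hc.symm⟩
  induction hb using Submodule.span_induction with
  | mem x hx =>
    obtain ⟨q, rfl⟩ := hx
    by_cases hq : q ∈ Z
    · obtain ⟨c, hc⟩ := h.exists_algebraMap q hq
      rw [h.conjSum_map_of_mem hq, hc]
      exact Submodule.smul_mem _ _ (Subalgebra.algebraMap_mem _ c)
    · rw [h.conjSum_eq_zero q hq]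
      exact Submodule.zero_mem _
  | zero => rw [map_zero]; exact Submodule.zero_mem _
  | add x y _ _ hx hy => rw [map_add]; exact Submodule.add_mem _ hx hy
  | smul c x _ hx => rw [map_smul]; exact Submodule.smul_mem _ _ hx

theorem sum_map_inv_mul_conjSum (h : IsFullyRamified K τ Z)
    {b : B} (hb : b ∈ Submodule.span K (Set.range τ)) :
    ∑ x, τ x⁻¹ * conjSum K τ (τ x * b) = ((Fintype.card Q * Nat.card Z : ℕ) : K) • b := by
  classical
  induction hb using Submodule.span_induction with
  | mem x hx =>
    obtain ⟨y, rfl⟩ := hx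
    have key (x : Q) : τ x⁻¹ * conjSum K τ (τ x * τ y) =
        if x * y ∈ Z then (Fintype.card Q : K) • τ y else 0 := by
      rw [← map_mul]
      split_ifs with hxy
      · rw [h.conjSum_map_of_mem hxy, mul_smul_comm, ← map_mul, inv_mul_cancel_left]
      · rw [h.conjSum_eq_zero _ hxy, mul_zero]
    simp_rw [key]
    rw [Fintype.sum_equiv (Equiv.mulRight y) (fun x ↦ if x * y ∈ Z then _ else _)
      (fun x ↦ if x ∈ Z then (Fintype.card Q : K) • τ y else 0) (fun _ ↦ rfl),
      ← Finset.sum_filter, Finset.sum_const, ← Fintype.card_subtype, ← Nat.cast_smul_eq_nsmul K,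
      smul_smul, Nat.card_eq_fintype_card]
    push_cast
    rw [mul_comm]
  | zero => simp
  | add x y _ _ hx hy => simp only [mul_add, map_add, Finset.sum_add_distrib, hx, hy, smul_add]
  | smul c x _ hx =>
    simp only [mul_smul_comm, map_smul, ← Finset.smul_sum, hx]
    rw [smul_comm]

theorem card_mul_card_ne_zero (h : IsFullyRamified K τ Z)
    : ((Fintype.card Q * Nat.card Z : ℕ) : K) ≠ 0 := by
  have h1 := h.card_ne_zero
  rw [← Nat.card_eq_fintype_card, ← Z.card_mul_index, Nat.cast_mul] at h1
  rw [Nat.cast_mul]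
  exact mul_ne_zero h.card_ne_zero (left_ne_zero_of_mul h1)

theorem exists_algebraMap_of_commute (h : IsFullyRamified K τ Z)
    {b : B} (hb : b ∈ Submodule.span K (Set.range τ))
    (hcomm : ∀ q, τ q * b = b * τ q) : ∃ c : K, b = algebraMap K B c := by
  obtain ⟨c, hc⟩ := h.exists_conjSum_eq hb
  rw [conjSum_eq_smul_of_commute τ hcomm] at hc
  refine ⟨(Fintype.card Q : K)⁻¹ * c, ?_⟩
  rw [map_mul, ← hc, ← Algebra.smul_def, smul_smul, inv_mul_cancel₀ h.card_ne_zero, one_smul]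

theorem exists_conjSum_ne_zero (h : IsFullyRamified K τ Z)
    {b : B} (hb : b ∈ Submodule.span K (Set.range τ)) (hb0 : b ≠ 0) :
    ∃ x, conjSum K τ (τ x * b) ≠ 0 := by
  by_contra! h0
  have h1 := h.sum_map_inv_mul_conjSum hb
  simp only [h0, mul_zero, Finset.sum_const_zero] at h1
  exact (smul_ne_zero h.card_mul_card_ne_zero hb0) h1.symm

theorem isSimpleRing (h : IsFullyRamified K τ Z)
    [Nontrivial B] (hspan : Submodule.span K (Set.range τ) = ⊤) :
    IsSimpleRing B := by
  refine ⟨⟨fun I ↦ ?_⟩⟩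
  by_cases hI : ∃ b ∈ I, b ≠ 0
  · right
    obtain ⟨b, hbI, hb0⟩ := hI
    have hmem (b : B) : b ∈ Submodule.span K (Set.range τ) := hspan ▸ Submodule.mem_top
    obtain ⟨x, hx⟩ := h.exists_conjSum_ne_zero (hmem b) hb0
    obtain ⟨c, hc⟩ := h.exists_conjSum_eq (hmem (τ x * b))
    have hc0 : c ≠ 0 := by
      rintro rfl
      exact hx (by rw [hc, map_zero])
    have h1 : conjSum K τ (τ x * b) ∈ I := by
      rw [conjSum_apply]
      exact sum_mem fun q _ ↦ I.mul_mem_right _ _ (I.mul_mem_left _ _ (I.mul_mem_left _ _ hbI))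
    have h2 : algebraMap K B c⁻¹ * conjSum K τ (τ x * b) ∈ I := I.mul_mem_left _ _ h1
    rw [hc, ← map_mul, inv_mul_cancel₀ hc0, map_one] at h2
    exact I.one_mem_iff.mp h2
  · left
    push Not at hI
    refine eq_bot_iff.mpr fun b hb ↦ ?_
    rw [hI b hb]
    exact zero_mem _

theorem linearIndependent_map_out (h : IsFullyRamified K τ Z) [Nontrivial B] :
    LinearIndependent K fun x : Q ⧸ Z ↦ τ x.out := by
  classical
  rw [Fintype.linearIndependent_iff]
  intro α hα y
  have h1 : conjSum K τ (τ y.out⁻¹ * ∑ x : Q ⧸ Z, α x • τ x.out) = 0 := by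
    rw [hα, mul_zero, map_zero]
  have h2 (x : Q ⧸ Z) : conjSum K τ (τ y.out⁻¹ * τ x.out) =
      if x = y then (Fintype.card Q : K) • 1 else 0 := by
    rw [← map_mul]
    split_ifs with hxy
    · rw [hxy, inv_mul_cancel, h.conjSum_map_of_mem Z.one_mem, map_one]
    · refine h.conjSum_eq_zero _ fun hmem ↦ hxy ?_
      rw [← x.out_eq', ← y.out_eq', eq_comm, QuotientGroup.eq]
      exact hmem
  simp only [Finset.mul_sum, mul_smul_comm, map_sum, map_smul, h2, smul_ite, smul_zero,
    Finset.sum_ite_eq', Finset.mem_univ, if_true] at h1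
  rw [smul_smul] at h1
  exact (mul_eq_zero.mp ((smul_eq_zero.mp h1).resolve_right one_ne_zero)).resolve_right
    h.card_ne_zero

theorem exists_map_eq_smul_map_out (h : IsFullyRamified K τ Z) (q : Q) :
    ∃ c : K, τ q = c • τ (q : Q ⧸ Z).out := by
  obtain ⟨z, hz⟩ := QuotientGroup.mk_out_eq_mul Z q
  obtain ⟨c, hc⟩ := h.exists_algebraMap _ (Z.inv_mem z.2)
  refine ⟨c, ?_⟩
  rw [Algebra.smul_def, ← hc, hc, Algebra.commutes, ← hc, ← map_mul, hz, mul_inv_cancel_right]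

noncomputable def quotientBasis (h : IsFullyRamified K τ Z)
    [Nontrivial B] (hspan : Submodule.span K (Set.range τ) = ⊤) :
    Module.Basis (Q ⧸ Z) K B :=
  Module.Basis.mk h.linearIndependent_map_out <| by
    rw [← hspan, Submodule.span_le]
    rintro _ ⟨q, rfl⟩
    obtain ⟨c, hc⟩ := h.exists_map_eq_smul_map_out q
    rw [hc]
    exact Submodule.smul_mem _ _ (Submodule.subset_span ⟨_, rfl⟩)

theorem quotientBasis_apply (h : IsFullyRamified K τ Z)
    [Nontrivial B] (hspan : Submodule.span K (Set.range τ) = ⊤)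
    (x : Q ⧸ Z) : h.quotientBasis hspan x = τ x.out := by
  simp [quotientBasis]

theorem sum_map_mul_sum_map (h : IsFullyRamified K τ Z) (φ : Q →* Q) (hφZ : ∀ z ∈ Z, φ z = z)
    (hφ : ∀ x, φ x * x⁻¹ ∈ Z → x ∈ Z) :
    (∑ x, τ (x * (φ x)⁻¹)) * (∑ x, τ (φ x * x⁻¹)) =
      ((Fintype.card Q * Nat.card Z : ℕ) : K) • 1 := by
  classical
  have hcomm (y : Q) : (∑ x, τ (x * (φ x)⁻¹)) * τ (φ y) = τ y * ∑ x, τ (x * (φ x)⁻¹) := by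
    rw [Finset.sum_mul, Finset.mul_sum]
    refine (Fintype.sum_equiv (Equiv.mulLeft y) _ _ fun x ↦ ?_).symm
    rw [← map_mul, ← map_mul]
    simp [mul_assoc]
  have h1 : (∑ x, τ (x * (φ x)⁻¹)) * (∑ x, τ (φ x * x⁻¹)) =
      conjSum K τ (∑ x, τ (x * (φ x)⁻¹)) := by
    rw [conjSum_apply, Finset.mul_sum]
    refine Finset.sum_congr rfl fun x _ ↦ ?_
    rw [map_mul, ← mul_assoc, hcomm]
  have h2 (x : Q) : conjSum K τ (τ (x * (φ x)⁻¹)) =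
      if x ∈ Z then (Fintype.card Q : K) • 1 else 0 := by
    split_ifs with hx
    · rw [hφZ x hx, mul_inv_cancel, h.conjSum_map_of_mem Z.one_mem, map_one]
    · refine h.conjSum_eq_zero _ fun hmem ↦ hx (hφ x ?_)
      simpa using Z.inv_mem hmem
  rw [h1, map_sum]
  simp_rw [h2]
  rw [← Finset.sum_filter, Finset.sum_const, ← Fintype.card_subtype, ← Nat.cast_smul_eq_nsmul K,
    smul_smul, Nat.card_eq_fintype_card, Nat.cast_mul, mul_comm]

end IsFullyRamified

end FullyRamified

theorem Equiv.Perm.card_orbits_mul_of_unique_fixed {E : Type*} [Finite E] {r : ℕ}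
    (hr : r.Prime) (σ : Equiv.Perm E) (hσ : σ ^ r = 1) (hσ1 : σ ≠ 1) (e : E)
    (hfix : ∀ x, σ x = x ↔ x = e) :
    Nat.card (MulAction.orbitRel.Quotient (Subgroup.zpowers σ) E) * r =
      Nat.card E + (r - 1) := by
  classical
  have := Fintype.ofFinite E
  have := Fact.mk hr
  have hcard : Fintype.card (Subgroup.zpowers σ) = r := by
    rw [Fintype.card_zpowers, orderOf_eq_prime hσ hσ1]
  have h := MulAction.sum_card_fixedBy_eq_card_orbits_mul_card_group (Subgroup.zpowers σ) E
  have hone (γ : Subgroup.zpowers σ) (hγ : γ ≠ 1) : Fintype.card (MulAction.fixedBy E γ) = 1 := by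
    have hmem : σ ∈ Subgroup.zpowers (γ : Equiv.Perm E) := by
      have h1 := mem_zpowers_of_prime_card (g := γ) (g' := ⟨σ, Subgroup.mem_zpowers σ⟩)
        (Nat.card_eq_fintype_card.trans hcard) hγ
      obtain ⟨k, hk⟩ := Subgroup.mem_zpowers_iff.mp h1
      exact Subgroup.mem_zpowers_iff.mpr ⟨k, by simpa using congrArg Subtype.val hk⟩
    have hset : MulAction.fixedBy E γ = {e} := by
      ext x
      rw [MulAction.mem_fixedBy, Set.mem_singleton_iff, ← hfix]
      constructor
      · intro hx
        obtain ⟨k, hk⟩ := Subgroup.mem_zpowers_iff.mp hmem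
        rw [← hk]
        exact Equiv.Perm.zpow_apply_eq_self_of_apply_eq_self hx k
      · intro hx
        obtain ⟨k, hk⟩ := Subgroup.mem_zpowers_iff.mp γ.2
        change (γ : Equiv.Perm E) x = x
        rw [← hk]
        exact Equiv.Perm.zpow_apply_eq_self_of_apply_eq_self hx k
    simp [hset]
  rw [← Finset.add_sum_erase _ _ (Finset.mem_univ 1),
    Finset.sum_congr rfl fun γ hγ ↦ hone γ (Finset.ne_of_mem_erase hγ), Finset.sum_const,
    Finset.card_erase_of_mem (Finset.mem_univ _), Finset.card_univ, hcard] at h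
  simp only [MulAction.fixedBy_one_eq_univ, Fintype.card_setUniv, smul_eq_mul, mul_one] at h
  rw [Nat.card_eq_fintype_card, Nat.card_eq_fintype_card]
  exact h.symm

theorem span_range_eq_toSubmodule_adjoin {K Q B : Type*} [Field K] [Group Q] [Ring B] [Algebra K B]
    (τ : Q →* B) :
    Submodule.span K (Set.range τ) = Subalgebra.toSubmodule (Algebra.adjoin K (Set.range τ)) := by
  rw [Algebra.adjoin_eq_span, ← MonoidHom.coe_mrange, Submonoid.closure_eq]

theorem IsFullyRamified.exists_intertwiner {K Q V : Type*} [Field K] [IsAlgClosed K] [Group Q]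
    [Fintype Q] [AddCommGroup V] [Module K V] [Nontrivial V] {τ : Q →* Module.End K V}
    {Z : Subgroup Q} (h : IsFullyRamified K τ Z) (φ : MulAut Q) (hφZ : ∀ z ∈ Z, φ z = z)
    (hφ : ∀ x, φ x * x⁻¹ ∈ Z → x ∈ Z) (T : Module.End K V) (hT : ∀ q, T * τ q = τ (φ q) * T)
    {r : ℕ} (hr : 0 < r) (hN : ∑ i ∈ Finset.range r, T ^ i = 0) :
    ∃ u ∈ Submodule.span K (Set.range τ), (∀ q, u * τ q = τ (φ q) * u) ∧
      ∑ i ∈ Finset.range r, u ^ i = 0 := by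
  have hTr : T ^ r = 1 := by
    have := geom_sum_mul T r
    rwa [hN, zero_mul, eq_comm, sub_eq_zero] at this
  obtain ⟨T', hTT', hT'T⟩ : ∃ T' : Module.End K V, T * T' = 1 ∧ T' * T = 1 :=
    ⟨T ^ (r - 1), by rw [← pow_succ', Nat.sub_add_cancel hr, hTr],
      by rw [← pow_succ, Nat.sub_add_cancel hr, hTr]⟩
  set u₀ : Module.End K V := ∑ x, τ (φ x * x⁻¹) with hu₀
  have hu₀τ (y : Q) : u₀ * τ y = τ (φ y) * u₀ := by
    rw [hu₀, Finset.sum_mul, Finset.mul_sum]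
    refine (Fintype.sum_equiv (Equiv.mulLeft y⁻¹) _ _ fun x ↦ ?_)
    rw [← map_mul, ← map_mul]
    simp [mul_assoc]
  have hTu₀ : T * u₀ = u₀ * T := by
    rw [hu₀, Finset.sum_mul, Finset.mul_sum]
    refine Fintype.sum_equiv φ.toEquiv _ _ fun x ↦ ?_
    rw [hT]
    simp
  have hu₀mem : u₀ ∈ Algebra.adjoin K (Set.range τ) :=
    sum_mem fun x _ ↦ Algebra.subset_adjoin ⟨_, rfl⟩
  set c := T' * u₀ with hc
  have hTc : T * c = u₀ := by rw [hc, ← mul_assoc, hTT', one_mul]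
  have hT'τ (q : Q) : T' * τ (φ q) = τ q * T' := by
    calc T' * τ (φ q) = T' * (τ (φ q) * T) * T' := by simp only [mul_assoc, hTT', mul_one]
      _ = τ q * T' := by rw [← hT, ← mul_assoc, hT'T, one_mul]
  have hcτ (q : Q) : c * τ q = τ q * c := by
    rw [hc, mul_assoc, hu₀τ, ← mul_assoc, hT'τ, mul_assoc]
  have hcT : Commute T c := by
    change T * c = c * T
    rw [hTc, hc, mul_assoc, ← hTu₀, ← mul_assoc, hT'T, one_mul]
  have hpow : u₀ ^ r = c ^ r := by rw [← hTc, hcT.mul_pow, hTr, one_mul]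
  obtain ⟨s, hs⟩ := h.exists_algebraMap_of_commute (b := u₀ ^ r)
    (by rw [span_range_eq_toSubmodule_adjoin]; exact pow_mem hu₀mem r)
    (fun q ↦ by rw [hpow]; exact ((show Commute c (τ q) from hcτ q).pow_left r).symm)
  obtain ⟨η, v, hv, hηv⟩ := c.exists_eq_smul_of_pow_eq_smul hr s
    (by rw [← hpow, hs, Algebra.algebraMap_eq_smul_one])
  have hη : η ≠ 0 := by
    rintro rfl
    have h0 : u₀ v = 0 := by rw [← hTc, Module.End.mul_apply, hηv, zero_smul, map_zero]
    have h1 := congrArg (fun f : Module.End K V ↦ f v) (h.sum_map_mul_sum_map φ.toMonoidHom hφZ hφ)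
    refine smul_ne_zero h.card_mul_card_ne_zero hv (h1.symm.trans ?_)
    exact (congrArg (⇑(∑ x, τ (x * (φ x)⁻¹))) h0).trans (map_zero _)
  have humem : η⁻¹ • u₀ ∈ Algebra.adjoin K (Set.range τ) := Subalgebra.smul_mem _ hu₀mem _
  refine ⟨η⁻¹ • u₀, by rw [span_range_eq_toSubmodule_adjoin]; exact humem,
    fun q ↦ by rw [smul_mul_assoc, hu₀τ, mul_smul_comm], ?_⟩
  have huT (x : V) (hx : c x = η • x) (i : ℕ) :
      ((η⁻¹ • u₀) ^ i) x = (T ^ i) x ∧ c ((T ^ i) x) = η • (T ^ i) x := by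
    induction i with
    | zero => simp [hx]
    | succ i ih =>
      have h2 : c ((T ^ (i + 1)) x) = η • (T ^ (i + 1)) x := by
        have := congrArg (fun f : Module.End K V ↦ f x) (hcT.pow_left (i + 1)).eq
        simp only [Module.End.mul_apply, hx, map_smul] at this
        exact this.symm
      refine ⟨?_, h2⟩
      rw [pow_succ', Module.End.mul_apply, ih.1, pow_succ', Module.End.mul_apply, ← hTc,
        LinearMap.smul_apply, Module.End.mul_apply, ih.2, map_smul, smul_smul, inv_mul_cancel₀ hη,
        one_smul]
  by_contra hb0
  obtain ⟨x, hx⟩ := h.exists_conjSum_ne_zero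
    (b := ∑ i ∈ Finset.range r, (η⁻¹ • u₀) ^ i)
    (by rw [span_range_eq_toSubmodule_adjoin]; exact sum_mem fun i _ ↦ pow_mem humem i) hb0
  obtain ⟨d, hd⟩ := h.exists_conjSum_eq
    (b := τ x * ∑ i ∈ Finset.range r, (η⁻¹ • u₀) ^ i)
    (by
      rw [span_range_eq_toSubmodule_adjoin]
      exact Subalgebra.mul_mem _ (Algebra.subset_adjoin ⟨x, rfl⟩)
        (sum_mem fun i _ ↦ pow_mem humem i))
  have hzero : conjSum K τ (τ x * ∑ i ∈ Finset.range r, (η⁻¹ • u₀) ^ i) v = 0 := by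
    rw [conjSum_apply, LinearMap.sum_apply]
    refine Finset.sum_eq_zero fun q _ ↦ ?_
    have hq : c (τ q⁻¹ v) = η • τ q⁻¹ v := by
      rw [← Module.End.mul_apply, hcτ, Module.End.mul_apply, hηv, map_smul]
    have h0 : (∑ i ∈ Finset.range r, (η⁻¹ • u₀) ^ i) (τ q⁻¹ v) = 0 := by
      rw [LinearMap.sum_apply, Finset.sum_congr rfl fun i _ ↦ (huT _ hq i).1,
        ← LinearMap.sum_apply, hN, LinearMap.zero_apply]
    rw [Module.End.mul_apply, Module.End.mul_apply, Module.End.mul_apply, h0, map_zero, map_zero]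
  rw [hd, Module.algebraMap_end_apply, smul_eq_zero] at hzero
  rw [hd, hzero.resolve_right hv, map_zero] at hx
  exact hx rfl

theorem IsFullyRamified.exists_finrank_centralizer_le {K Q B : Type*} [Field K] [Group Q]
    [Fintype Q] [Ring B] [Nontrivial B] [Algebra K B] {τ : Q →* B} {Z : Subgroup Q} [Z.Normal]
    (h : IsFullyRamified K τ Z) (hspan : Submodule.span K (Set.range τ) = ⊤) (φ : MulAut Q)
    (hφZ : ∀ z ∈ Z, φ z = z) (hφ : ∀ x, φ x * x⁻¹ ∈ Z → x ∈ Z) (hZ : Z ≠ ⊤) {r : ℕ}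
    (hr : r.Prime) (hφr : φ ^ r = 1) (u u' : B) (huu' : u * u' = 1)
    (hu : ∀ q, u * τ q = τ (φ q) * u) :
    ∃ k, Module.finrank K (Subalgebra.centralizer K {u}) ≤ k ∧ k * r = Z.index + (r - 1) := by
  classical
  have hmap : Subgroup.map (φ : Q →* Q) Z = Z := by
    ext z
    constructor
    · rintro ⟨y, hy, rfl⟩
      have : φ y = y := hφZ y hy
      exact (this.symm ▸ hy : φ y ∈ Z)
    · exact fun hz ↦ ⟨z, hz, hφZ z hz⟩
  let σ : Equiv.Perm (Q ⧸ Z) := (QuotientGroup.congr Z Z φ hmap).toEquiv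
  have hσ (q : Q) : σ q = (φ q : Q ⧸ Z) := rfl
  have hσpow (k : ℕ) (q : Q) : (σ ^ k) (q : Q ⧸ Z) = ((φ ^ k) q : Q ⧸ Z) := by
    induction k with
    | zero => simp
    | succ k ih => rw [pow_succ', Equiv.Perm.mul_apply, ih, hσ, pow_succ', MulAut.mul_apply]
  have hfix (x : Q ⧸ Z) : σ x = x ↔ x = ((1 : Q) : Q ⧸ Z) := by
    obtain ⟨q, rfl⟩ := QuotientGroup.mk_surjective x
    constructor
    · intro hx
      rw [hσ, eq_comm, QuotientGroup.eq] at hx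
      refine QuotientGroup.eq.mpr ?_
      rw [mul_one]
      refine Z.inv_mem (hφ q ?_)
      exact ‹Z.Normal›.mem_comm hx
    · intro hx
      rw [hx, hσ, map_one]
  have hσ1 : σ ≠ 1 := by
    intro h1
    refine hZ (eq_top_iff.mpr fun q _ ↦ hφ q ?_)
    have h2 : σ q = q := by rw [h1]; rfl
    rw [hσ, eq_comm, QuotientGroup.eq] at h2
    exact ‹Z.Normal›.mem_comm h2
  have horb := Equiv.Perm.card_orbits_mul_of_unique_fixed hr σ
    (Equiv.ext fun x ↦ by
      obtain ⟨q, rfl⟩ := QuotientGroup.mk_surjective x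
      rw [hσpow, hφr]
      rfl) hσ1 _ hfix
  refine ⟨_, ?_, horb⟩
  have hscal (x : Q ⧸ Z) : ∃ s : K, τ (φ x.out) = s • τ (σ x).out := by
    obtain ⟨s, hs⟩ := h.exists_map_eq_smul_map_out (φ x.out)
    refine ⟨s, hs.trans ?_⟩
    rw [← hσ, QuotientGroup.out_eq']
  choose s hs using hscal
  let b := h.quotientBasis hspan
  have hb (x : Q ⧸ Z) : b x = τ x.out := h.quotientBasis_apply hspan x
  have hrepr (a : B) (ha : u * a = a * u) (x : Q ⧸ Z) : b.repr a (σ x) = s x * b.repr a x := by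
    have h1 : a = ∑ x, (b.repr a x * s x) • b (σ x) := by
      have h2 : u * a * u' = a := by rw [ha, mul_assoc, huu', mul_one]
      rw [← h2]
      nth_rewrite 1 [← b.sum_repr a]
      rw [Finset.mul_sum, Finset.sum_mul, h2]
      refine Finset.sum_congr rfl fun x _ ↦ ?_
      rw [mul_smul_comm, hb, hu, smul_mul_assoc, mul_assoc, huu', mul_one, hs, smul_smul, hb]
    have h3 : a = ∑ y, (b.repr a (σ.symm y) * s (σ.symm y)) • b y := by
      rw [← Equiv.sum_comp σ]
      simpa using h1
    nth_rewrite 1 [h3]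
    rw [b.repr_sum_self, σ.symm_apply_apply, mul_comm]
  let Ω := MulAction.orbitRel.Quotient (Subgroup.zpowers σ) (Q ⧸ Z)
  have := Fintype.ofFinite Ω
  let ψ : Subalgebra.centralizer K {u} →ₗ[K] (Ω → K) :=
    LinearMap.pi fun ω ↦ Finsupp.lapply ω.out ∘ₗ b.repr.toLinearMap ∘ₗ
      (Subalgebra.centralizer K {u}).val.toLinearMap
  have hψ : Function.Injective ψ := by
    rw [← LinearMap.ker_eq_bot, LinearMap.ker_eq_bot']
    rintro ⟨a, ha⟩ h0
    have hcomm : u * a = a * u := (Subalgebra.mem_centralizer_iff K).mp ha u rfl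
    have hpow (k : ℕ) (x : Q ⧸ Z) (hx : b.repr a x = 0) : b.repr a ((σ ^ k) x) = 0 := by
      induction k with
      | zero => exact hx
      | succ k ih => rw [pow_succ', Equiv.Perm.mul_apply, hrepr a hcomm, ih, mul_zero]
    refine Subtype.ext (b.ext_elem fun x ↦ ?_)
    simp only [ZeroMemClass.coe_zero, map_zero, Finsupp.coe_zero, Pi.zero_apply]
    obtain ⟨⟨γ, hγ⟩, hγx⟩ : x ∈ MulAction.orbit (Subgroup.zpowers σ)
        (Quotient.out (Quotient.mk'' x : Ω)) :=
      MulAction.orbitRel_apply.mp (Quotient.exact (Quotient.out_eq (Quotient.mk'' x : Ω)).symm)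
    obtain ⟨k, rfl⟩ := (mem_powers_iff_mem_zpowers.mpr hγ)
    rw [← hγx]
    exact hpow k _ (congrFun h0 (Quotient.mk'' x))
  refine (LinearMap.finrank_le_finrank_of_injective hψ).trans ?_
  rw [Module.finrank_fintype_fun_eq_card, Nat.card_eq_fintype_card]

theorem add_one_eq_of_sq_le {r n k : ℕ} (hr : r.Prime) (hn : n ^ 2 ≠ 1)
    (hk : k * r = n ^ 2 + (r - 1)) (hle : n ^ 2 ≤ (r - 1) * k) (hn0 : n ≠ 0) : n + 1 = r := by
  obtain ⟨s, rfl⟩ : ∃ s, r = s + 1 := ⟨r - 1, (Nat.sub_add_cancel hr.one_le).symm⟩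
  obtain ⟨m, rfl⟩ : ∃ m, n = m + 1 := ⟨n - 1, (Nat.sub_add_cancel (Nat.pos_of_ne_zero hn0)).symm⟩
  have hm0 : m ≠ 0 := by rintro rfl; exact hn rfl
  simp only [Nat.add_sub_cancel] at *
  have hsq : (m + 1) ^ 2 ≤ s ^ 2 := by nlinarith
  have hms : m + 1 ≤ s := (Nat.pow_le_pow_iff_left two_ne_zero).mp hsq
  have hdvd : s + 1 ∣ m * (m + 2) := by
    have h1 : m * (m + 2) + (s + 1) = k * (s + 1) := by rw [hk]; ring
    exact (Nat.dvd_add_left (dvd_refl (s + 1))).mp (h1 ▸ Dvd.intro_left k rfl)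
  rcases hr.dvd_mul.mp hdvd with h | h
  · have := Nat.le_of_dvd (Nat.pos_of_ne_zero hm0) h
    omega
  · have := Nat.le_of_dvd (by omega) h
    omega

theorem IsFullyRamified.exists_index_eq_sq {K Q V : Type*} [Field K] [IsAlgClosed K] [Group Q]
    [Fintype Q] [AddCommGroup V] [Module K V] [Nontrivial V] {τ : Q →* Module.End K V}
    {Z : Subgroup Q} [Z.Normal] (h : IsFullyRamified K τ Z) (hZ : Z ≠ ⊤) (φ : MulAut Q)
    (hφZ : ∀ z ∈ Z, φ z = z) (hφ : ∀ x, φ x * x⁻¹ ∈ Z → x ∈ Z) {r : ℕ} (hr : r.Prime)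
    (hrK : (r : K) ≠ 0) (hφr : φ ^ r = 1) (T : Module.End K V)
    (hT : ∀ q, T * τ q = τ (φ q) * T) (hN : ∑ i ∈ Finset.range r, T ^ i = 0) :
    ∃ n, Z.index = n ^ 2 ∧ n + 1 = r := by
  obtain ⟨u, hu, huτ, huN⟩ := h.exists_intertwiner φ hφZ hφ T hT hr.pos hN
  let A := Algebra.adjoin K (Set.range τ)
  let τA : Q →* A := τ.codRestrict A fun q ↦ Algebra.subset_adjoin ⟨q, rfl⟩
  have hcoe (q : Q) : (τA q : Module.End K V) = τ q := rfl
  have hconj (a : A) : (conjSum K τA a : Module.End K V) = conjSum K τ a := by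
    simp [conjSum_apply, hcoe]
  have hA : IsFullyRamified K τA Z :=
    ⟨h.card_ne_zero, fun z hz ↦ (h.exists_algebraMap z hz).imp fun c hc ↦ Subtype.ext hc,
      fun x hx ↦ Subtype.ext ((hconj _).trans (h.conjSum_eq_zero x hx))⟩
  have hspan : Submodule.span K (Set.range τA) = ⊤ := by
    refine Submodule.map_injective_of_injective (f := A.val.toLinearMap) Subtype.val_injective ?_
    rw [Submodule.map_span, ← Set.range_comp, Submodule.map_top]
    change Submodule.span K (Set.range τ) = _
    rw [span_range_eq_toSubmodule_adjoin]
    ext x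
    simp [A]
  have := hA.isSimpleRing hspan
  have hfin : FiniteDimensional K A := Module.Finite.of_basis (hA.quotientBasis hspan)
  have hindex : Module.finrank K A = Z.index := by
    classical
    rw [Module.finrank_eq_card_basis (hA.quotientBasis hspan), Subgroup.index,
      Nat.card_eq_fintype_card]
  rw [span_range_eq_toSubmodule_adjoin] at hu
  have huN' : ∑ i ∈ Finset.range r, (⟨u, hu⟩ : A) ^ i = 0 := by
    apply Subtype.ext
    simpa using huN
  obtain ⟨n, hn, hle⟩ :=
    IsSimpleRing.exists_finrank_eq_sq_le_mul_finrank_centralizer hrK (⟨u, hu⟩ : A) huN'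
  have hur : (⟨u, hu⟩ : A) * (⟨u, hu⟩ : A) ^ (r - 1) = 1 := by
    have := geom_sum_mul (⟨u, hu⟩ : A) r
    rw [huN', zero_mul, eq_comm, sub_eq_zero] at this
    rw [← pow_succ', Nat.sub_add_cancel hr.one_le, this]
  obtain ⟨k, hk, hkr⟩ := hA.exists_finrank_centralizer_le hspan φ hφZ hφ hZ hr hφr ⟨u, hu⟩ _ hur
    fun q ↦ Subtype.ext (huτ q)
  rw [hindex] at hn
  rw [hn] at hkr
  refine ⟨n, hn, add_one_eq_of_sq_le hr ?_ hkr (hle.trans (Nat.mul_le_mul_left _ hk)) ?_⟩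
  · rw [← hn]
    exact fun h1 ↦ hZ (Subgroup.index_eq_one.mp h1)
  · rintro rfl
    exact Z.index_ne_zero_of_finite (hn.trans (by norm_num))

theorem Module.End.exists_submodule_forall_eq_smul {K M : Type*} [Field K] [IsAlgClosed K]
    [AddCommGroup M] [Module K M] (S : Set (Module.End K M)) (M₀ : Submodule K M) (hM₀ : M₀ ≠ ⊥)
    (hS : ∀ f ∈ S, ∀ v ∈ M₀, f v ∈ M₀) (t : Finset (Module.End K M))
    (ht : ∀ z ∈ t, z ∈ S ∧ (∀ f ∈ S, Commute z f) ∧ ∃ k : ℕ, 0 < k ∧ z ^ k = 1) :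
    ∃ V ≤ M₀, V ≠ ⊥ ∧ (∀ f ∈ S, ∀ v ∈ V, f v ∈ V) ∧
      ∀ z ∈ t, ∃ c : K, ∀ v ∈ V, z v = c • v := by
  classical
  induction t using Finset.induction_on with
  | empty => exact ⟨M₀, le_rfl, hM₀, hS, by simp⟩
  | insert z t _ ih =>
    obtain ⟨V, hVM, hV, hVS, hVt⟩ := ih fun y hy ↦ ht y (Finset.mem_insert_of_mem hy)
    obtain ⟨hzS, hzcomm, k, hk, hzk⟩ := ht z (Finset.mem_insert_self z t)
    have := Submodule.nontrivial_iff_ne_bot.mpr hV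
    have hres (v : V) (i : ℕ) : (((z.restrict (hVS z hzS)) ^ i) v : M) = (z ^ i) v := by
      induction i with
      | zero => rfl
      | succ i ih =>
        rw [pow_succ', pow_succ', Module.End.mul_apply, Module.End.mul_apply, ← ih]
        rfl
    obtain ⟨c, v, hv, hcv⟩ :=
      Module.End.exists_eq_smul_of_pow_eq_smul (z.restrict (hVS z hzS)) hk 1 <| by
        ext v
        rw [hres, hzk]
        simp
    refine ⟨V ⊓ z.eigenspace c, inf_le_left.trans hVM, ?_, ?_, ?_⟩
    · refine (Submodule.ne_bot_iff _).mpr ⟨v, ⟨v.2, ?_⟩, by simpa using hv⟩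
      exact Module.End.mem_eigenspace_iff.mpr (congrArg Subtype.val hcv)
    · rintro f hf x ⟨hxV, hx⟩
      refine ⟨hVS f hf x hxV, Module.End.mem_eigenspace_iff.mpr ?_⟩
      rw [← Module.End.mul_apply, (hzcomm f hf).eq, Module.End.mul_apply,
        Module.End.mem_eigenspace_iff.mp hx, map_smul]
    · intro y hy
      rcases Finset.mem_insert.mp hy with rfl | hy
      · exact ⟨c, fun x hx ↦ Module.End.mem_eigenspace_iff.mp hx.2⟩
      · exact (hVt y hy).imp fun d hd x hx ↦ hd x hx.1

section Centralizing

variable {Q B : Type*} [Group Q] [Ring B]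

/-- The elements of `Q` whose image commutes with the whole image of `τ`. -/
def MonoidHom.preimageCenterRange (τ : Q →* B) : Subgroup Q where
  carrier := {x | ∀ y, Commute (τ x) (τ y)}
  one_mem' y := by rw [map_one]; exact Commute.one_left _
  mul_mem' hx hx' y := by rw [map_mul]; exact (hx y).mul_left (hx' y)
  inv_mem' {x} hx y := by
    have h := hx y
    calc τ x⁻¹ * τ y = τ x⁻¹ * (τ y * τ x) * τ x⁻¹ := by
          rw [mul_assoc, mul_assoc, map_mul_map_inv, mul_one]
      _ = τ y * τ x⁻¹ := by rw [← h.eq, ← mul_assoc, map_inv_mul_map, one_mul]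

instance MonoidHom.normal_preimageCenterRange (τ : Q →* B) : τ.preimageCenterRange.Normal where
  conj_mem x hx q y := by
    have h : τ (q * x * q⁻¹) = τ x := by
      rw [map_mul, map_mul, ← (hx q).eq, mul_assoc, map_mul_map_inv, mul_one]
    rw [h]
    exact hx y

end Centralizing

open scoped commutatorElement in
theorem isFullyRamified_center {K Q B : Type*} [Field K] [Group Q] [Fintype Q] [Ring B]
    [Algebra K B] {τ : Q →* B} (hcard : (Fintype.card Q : K) ≠ 0)
    (hscal : ∀ z ∈ Subgroup.center Q, ∃ c : K, τ z = algebraMap K B c)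
    (hcl : ∀ x y : Q, ⁅x, y⁆ ∈ Subgroup.center Q)
    (hcent : τ.preimageCenterRange ≤ Subgroup.center Q) :
    IsFullyRamified K τ (Subgroup.center Q) := by
  refine ⟨hcard, hscal, fun x hx ↦ ?_⟩
  have h1 : ¬ ∀ y, Commute (τ x) (τ y) := fun h ↦ hx (hcent h)
  push Not at h1
  obtain ⟨y, hy⟩ := h1
  obtain ⟨c, hc⟩ := hscal _ (hcl y x)
  have h2 : τ (y * x * y⁻¹) = c • τ x := by
    rw [← inv_mul_cancel_right (y * x * y⁻¹) x, ← commutatorElement_def, map_mul, hc,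
      Algebra.smul_def]
  have h3 : conjSum K τ (τ (y * x * y⁻¹)) = conjSum K τ (τ x) := by
    rw [conjSum_apply, conjSum_apply]
    refine Fintype.sum_equiv (Equiv.mulRight y) _ _ fun q ↦ ?_
    simp only [← map_mul, Equiv.coe_mulRight]
    congr 1
    group
  rw [h2, map_smul] at h3
  by_contra hne
  have hc1 : c = 1 := by
    have h4 : (c - 1) • conjSum K τ (τ x) = 0 := by rw [sub_smul, h3, one_smul, sub_self]
    exact sub_eq_zero.mp ((smul_eq_zero.mp h4).resolve_right hne)
  refine hy ?_
  rw [hc1, one_smul] at h2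
  change τ x * τ y = τ y * τ x
  nth_rewrite 1 [← h2]
  rw [← map_mul, inv_mul_cancel_right, map_mul]

open scoped commutatorElement in
theorem exists_index_center_eq_sq {K Q M : Type*} [Field K] [IsAlgClosed K] [Group Q]
    [Fintype Q] [AddCommGroup M] [Module K M] (τ : Q →* Module.End K M)
    (hcard : (Fintype.card Q : K) ≠ 0) (φ : MulAut Q)
    (hφZ : ∀ z ∈ Subgroup.center Q, φ z = z)
    (hφ : ∀ x, φ x * x⁻¹ ∈ Subgroup.center Q → x ∈ Subgroup.center Q)
    (hcl : ∀ x y : Q, ⁅x, y⁆ ∈ Subgroup.center Q)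
    (hmin : ∀ H : Subgroup Q, H.Normal → (∀ x ∈ H, φ x ∈ H) → H ≠ ⊤ → H ≤ Subgroup.center Q)
    (a b : Q) (hab : τ ⁅a, b⁆ ≠ 1) {r : ℕ} (hr : r.Prime) (hrK : (r : K) ≠ 0) (hφr : φ ^ r = 1)
    (T : Module.End K M) (hT : ∀ q, T * τ q = τ (φ q) * T)
    (hN : ∑ i ∈ Finset.range r, T ^ i = 0) :
    ∃ n, (Subgroup.center Q).index = n ^ 2 ∧ n + 1 = r := by
  classical
  let S : Set (Module.End K M) := insert T (Set.range τ)
  have hcenter (z : Q) (hz : z ∈ Subgroup.center Q) (f : Module.End K M) (hf : f ∈ S) :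
      Commute (τ z) f := by
    rcases hf with rfl | ⟨q, rfl⟩
    · have := hT z
      rw [hφZ z hz] at this
      exact this.symm
    · change τ z * τ q = τ q * τ z
      rw [← map_mul, ← map_mul, Subgroup.mem_center_iff.mp hz q]
  set z₀ := ⁅a, b⁆
  let N₀ : Module.End K M := ∑ i ∈ Finset.range (Fintype.card Q), τ z₀ ^ i
  have hz₀ : τ z₀ ^ Fintype.card Q = 1 := by rw [← map_pow, pow_card_eq_one, map_one]
  obtain ⟨V, hVM, hV, hVS, hVt⟩ := Module.End.exists_submodule_forall_eq_smul S (LinearMap.ker N₀)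
    (by
      intro hbot
      refine hab (sub_eq_zero.mp (LinearMap.ext fun v ↦ ?_))
      have : (τ z₀ - 1) v ∈ LinearMap.ker N₀ := by
        rw [LinearMap.mem_ker, ← Module.End.mul_apply, geom_sum_mul, hz₀, sub_self,
          LinearMap.zero_apply]
      rw [hbot] at this
      exact (Submodule.mem_bot K).mp this)
    (by
      intro f hf v hv
      have hcomm : Commute N₀ f :=
        Commute.sum_left _ _ _ fun i _ ↦ (hcenter z₀ (hcl a b) f hf).pow_left i
      rw [LinearMap.mem_ker] at hv ⊢
      rw [← Module.End.mul_apply, hcomm.eq, Module.End.mul_apply, hv, map_zero])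
    ((Finset.univ.filter (· ∈ Subgroup.center Q)).image τ)
    (by
      intro f hf
      obtain ⟨z, hz, rfl⟩ := Finset.mem_image.mp hf
      refine ⟨Or.inr ⟨z, rfl⟩, hcenter z (Finset.mem_filter.mp hz).2, Fintype.card Q,
        Fintype.card_pos, ?_⟩
      rw [← map_pow, pow_card_eq_one, map_one])
  have := Submodule.nontrivial_iff_ne_bot.mpr hV
  have hTV := hVS T (Set.mem_insert T _)
  have hτV (q : Q) := hVS (τ q) (Or.inr ⟨q, rfl⟩)
  let TV : Module.End K V := T.restrict hTV
  let τV : Q →* Module.End K V :=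
    { toFun := fun q ↦ (τ q).restrict (hτV q)
      map_one' := by ext v; simp
      map_mul' := fun x y ↦ by ext v; simp }
  have hτVcoe (q : Q) (v : V) : (τV q v : M) = τ q v := rfl
  have hTVτ (q : Q) : TV * τV q = τV (φ q) * TV := by
    ext v
    exact congrArg (fun f : Module.End K M ↦ f v) (hT q)
  have hTVpow (i : ℕ) (v : V) : ((TV ^ i) v : M) = (T ^ i) v := by
    induction i with
    | zero => rfl
    | succ i ih => rw [pow_succ', pow_succ', Module.End.mul_apply, Module.End.mul_apply, ← ih]; rfl
  have hNV : ∑ i ∈ Finset.range r, TV ^ i = 0 := by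
    ext v
    have := congrArg (fun f : Module.End K M ↦ f v) hN
    simpa [LinearMap.sum_apply, hTVpow] using this
  have hscal (z : Q) (hz : z ∈ Subgroup.center Q) :
      ∃ c : K, τV z = algebraMap K (Module.End K V) c := by
    obtain ⟨c, hc⟩ := hVt (τ z)
      (Finset.mem_image_of_mem τ (Finset.mem_filter.mpr ⟨Finset.mem_univ z, hz⟩))
    exact ⟨c, by ext v; exact hc v v.2⟩
  have hz₀V : τV z₀ ≠ 1 := by
    intro h1
    obtain ⟨v, hv⟩ := exists_ne (0 : V)
    have h2 : τ z₀ v = v := by rw [← hτVcoe, h1]; rfl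
    have h3 (i : ℕ) : (τ z₀ ^ i) v = v := by
      induction i with
      | zero => rfl
      | succ i ih => rw [pow_succ', Module.End.mul_apply, ih, h2]
    have h4 : N₀ v = 0 := hVM v.2
    simp only [N₀, LinearMap.sum_apply, h3, Finset.sum_const, Finset.card_range] at h4
    rw [← Nat.cast_smul_eq_nsmul K, smul_eq_zero] at h4
    exact hv (Subtype.ext (h4.resolve_left hcard))
  have hnot : a ∉ τV.preimageCenterRange := by
    intro ha
    refine hz₀V ?_
    change τV ⁅a, b⁆ = 1
    rw [commutatorElement_def, map_mul, map_mul, map_mul, (ha b).eq, mul_assoc (τV b),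
      map_mul_map_inv, mul_one, map_mul_map_inv]
  have hTVr : TV ^ (r - 1) * TV = 1 ∧ TV * TV ^ (r - 1) = 1 := by
    have := geom_sum_mul TV r
    rw [hNV, zero_mul, eq_comm, sub_eq_zero] at this
    rw [← pow_succ, ← pow_succ', Nat.sub_add_cancel hr.one_le]
    exact ⟨this, this⟩
  have hcent : τV.preimageCenterRange ≤ Subgroup.center Q := by
    refine hmin _ inferInstance (fun x hx y ↦ ?_) fun htop ↦ hnot (htop ▸ Subgroup.mem_top a)
    obtain ⟨y, rfl⟩ := φ.surjective y
    have h1 : τV (φ x) * τV (φ y) * TV = τV (φ y) * τV (φ x) * TV := by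
      rw [mul_assoc, ← hTVτ, ← mul_assoc, ← hTVτ, mul_assoc, (hx y).eq, ← mul_assoc, hTVτ,
        mul_assoc, hTVτ, mul_assoc]
    calc τV (φ x) * τV (φ y) = τV (φ x) * τV (φ y) * TV * TV ^ (r - 1) := by
          rw [mul_assoc _ TV, hTVr.2, mul_one]
      _ = τV (φ y) * τV (φ x) := by rw [h1, mul_assoc _ TV, hTVr.2, mul_one]
  have hZ : Subgroup.center Q ≠ ⊤ := by
    intro htop
    refine hab ?_
    have ha : a ∈ Subgroup.center Q := htop ▸ Subgroup.mem_top a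
    rw [show z₀ = 1 from commutatorElement_eq_one_iff_mul_comm.mpr
      (Subgroup.mem_center_iff.mp ha b).symm, map_one]
  exact (isFullyRamified_center hcard hscal hcl hcent).exists_index_eq_sq hZ φ hφZ hφ hr hrK hφr
    TV hTVτ hNV

section PrimeOrder

variable {G : Type*} [Group G] {g : G} {r : ℕ}

theorem Commute.of_pow_right_of_coprime {x : G} {i : ℕ} (hgr : g ^ r = 1) (hi : i.Coprime r)
    (h : Commute x (g ^ i)) : Commute x g := by
  have h1 := h.zpow_right (i.gcdA r)
  have h2 : (g ^ i) ^ i.gcdA r = g := by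
    have := Nat.gcd_eq_gcd_ab i r
    rw [hi.gcd_eq_one] at this
    calc (g ^ i) ^ i.gcdA r = g ^ ((i : ℤ) * i.gcdA r) := by rw [zpow_mul, zpow_natCast]
      _ = g ^ (((1 : ℕ) : ℤ) - r * i.gcdB r) := by rw [this, add_sub_cancel_right]
      _ = g := by rw [zpow_sub, zpow_mul, zpow_natCast, zpow_natCast, hgr]; simp
  rwa [h2] at h1

theorem pow_mul_mul_inv_mem {H : Subgroup G} (hgH : ∀ h ∈ H, g * h * g⁻¹ ∈ H) (i : ℕ) :
    ∀ h ∈ H, g ^ i * h * (g ^ i)⁻¹ ∈ H := by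
  induction i with
  | zero => simp
  | succ i ih =>
    intro h hh
    have := hgH _ (ih h hh)
    rwa [show g ^ (i + 1) * h * (g ^ (i + 1))⁻¹ = g * (g ^ i * h * (g ^ i)⁻¹) * g⁻¹ by
      rw [pow_succ']; group]

theorem MonoidHom.eq_one_of_fixedPointFree {K B : Type*} [Field K] [Ring B] [Algebra K B]
    (τ : G →* B) (H : Subgroup G) [Finite H] (hcard : (Nat.card H : K) ≠ 0)
    (hgH : ∀ h ∈ H, g * h * g⁻¹ ∈ H) (hfree : ∀ h ∈ H, Commute h g → h = 1)
    (hr : r.Prime) (hgr : g ^ r = 1) (hN : ∑ i ∈ Finset.range r, τ g ^ i = 0) :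
    ∀ h ∈ H, τ h = 1 := by
  classical
  have := Fintype.ofFinite H
  let e : B := ∑ h : H, τ h
  have hsum (i : ℕ) (hi : i ∈ Finset.range r \ {0}) :
      ∑ h : H, τ h * τ g ^ i * τ (h : G)⁻¹ = e * τ g ^ i := by
    rw [Finset.mem_sdiff, Finset.mem_range, Finset.mem_singleton] at hi
    have hcop : i.Coprime r := (Nat.coprime_of_lt_prime hi.2 hi.1 hr).symm
    let c : H → H := fun h ↦ ⟨h * (g ^ i * (h : G)⁻¹ * (g ^ i)⁻¹),
      H.mul_mem h.2 (pow_mul_mul_inv_mem hgH i _ (H.inv_mem h.2))⟩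
    have hc : Function.Injective c := by
      intro h k hhk
      have h1 : (h : G) * (g ^ i * (h : G)⁻¹ * (g ^ i)⁻¹) =
        k * (g ^ i * (k : G)⁻¹ * (g ^ i)⁻¹) := congrArg Subtype.val hhk
      have h2 : Commute ((k : G)⁻¹ * h) (g ^ i) := by
        change (k : G)⁻¹ * h * g ^ i = g ^ i * ((k : G)⁻¹ * h)
        calc (k : G)⁻¹ * h * g ^ i
            = (k : G)⁻¹ * (h * (g ^ i * (h : G)⁻¹ * (g ^ i)⁻¹)) * g ^ i * h := by group
          _ = g ^ i * ((k : G)⁻¹ * h) := by rw [h1]; group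
      have h3 := hfree _ (H.mul_mem (H.inv_mem k.2) h.2) (h2.of_pow_right_of_coprime hgr hcop)
      exact Subtype.ext (inv_mul_eq_one.mp h3).symm
    rw [Finset.sum_mul]
    refine Fintype.sum_equiv (Equiv.ofBijective c (Finite.injective_iff_bijective.mp hc)) _ _
      fun h ↦ ?_
    simp only [Equiv.ofBijective_apply, c, ← map_pow, ← map_mul]
    congr 1
    group
  have hsplit (f : ℕ → B) : ∑ i ∈ Finset.range r, f i = f 0 + ∑ i ∈ Finset.range r \ {0}, f i := by
    rw [← Finset.sum_sdiff (Finset.singleton_subset_iff.mpr (Finset.mem_range.mpr hr.pos)),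
      Finset.sum_singleton, add_comm]
  have he : e = (Nat.card H : B) := by
    have h1 : ∑ i ∈ Finset.range r, ∑ h : H, τ h * τ g ^ i * τ (h : G)⁻¹ = 0 := by
      rw [Finset.sum_comm]
      refine Finset.sum_eq_zero fun h _ ↦ ?_
      rw [← Finset.sum_mul, ← Finset.mul_sum, hN, mul_zero, zero_mul]
    rw [hsplit, Finset.sum_congr rfl hsum, ← Finset.mul_sum] at h1
    rw [hsplit, pow_zero, add_comm, ← eq_neg_iff_add_eq_zero] at hN
    rw [hN] at h1
    simp only [pow_zero, mul_one, ← map_mul, mul_inv_cancel, map_one, Finset.sum_const,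
      Finset.card_univ, nsmul_eq_mul, mul_neg, ← Nat.card_eq_fintype_card] at h1
    exact (eq_of_sub_eq_zero (by rw [sub_eq_add_neg]; exact h1)).symm
  intro h hh
  have h1 : τ h * e = e := by
    rw [Finset.mul_sum]
    refine Fintype.sum_equiv (Equiv.mulLeft (⟨h, hh⟩ : H)) _ _ fun k ↦ ?_
    rw [← map_mul]
    rfl
  have h2 : (Nat.card H : B) = algebraMap K B (Nat.card H : K) := (map_natCast _ _).symm
  rw [he, h2, ← Algebra.commutes, ← Algebra.smul_def, Algebra.algebraMap_eq_smul_one] at h1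
  exact smul_right_injective B hcard h1

theorem MulAut.apply_eq_self_of_apply_mul_inv {φ : MulAut G} {s : ℕ} {q : G} (hφr : φ ^ r = 1)
    (hs : s.Coprime r) (hqs : (φ q * q⁻¹) ^ s = 1) (hc : φ (φ q * q⁻¹) = φ q * q⁻¹) :
    φ q = q := by
  have h1 (n : ℕ) : (φ ^ n) q = (φ q * q⁻¹) ^ n * q := by
    induction n with
    | zero => simp
    | succ n ih =>
      rw [pow_succ', MulAut.mul_apply, ih, map_mul, map_pow, hc, pow_succ, mul_assoc,
        inv_mul_cancel_right]
  have h2 : (φ q * q⁻¹) ^ r = 1 := by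
    have := h1 r
    rwa [hφr, MulAut.one_apply, eq_comm, mul_eq_right] at this
  have h3 := Nat.dvd_gcd (orderOf_dvd_of_pow_eq_one hqs) (orderOf_dvd_of_pow_eq_one h2)
  rw [hs.gcd_eq_one] at h3
  exact mul_inv_eq_one.mp (orderOf_eq_one_iff.mp (Nat.dvd_one.mp h3))

theorem MonoidHom.commute_of_forall_mul_comm {K B : Type*} [Field K] [Ring B] [Algebra K B]
    (τ : G →* B) (hτ : Function.Injective τ) (H : Subgroup G) [Finite H]
    (hcard : (Nat.card H : K) ≠ 0) (hcop : (Nat.card H).Coprime r)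
    (hgH : ∀ h ∈ H, g * h * g⁻¹ ∈ H) (hH : ∀ x ∈ H, ∀ y ∈ H, x * y = y * x)
    (hr : r.Prime) (hgr : g ^ r = 1) (hN : ∑ i ∈ Finset.range r, τ g ^ i = 0) :
    ∀ h ∈ H, h * g = g * h := by
  let D : Subgroup G :=
    { carrier := {d | ∃ h ∈ H, g * h * g⁻¹ * h⁻¹ = d}
      one_mem' := ⟨1, H.one_mem, by simp⟩
      mul_mem' := by
        rintro _ _ ⟨h, hh, rfl⟩ ⟨k, hk, rfl⟩
        refine ⟨h * k, H.mul_mem hh hk, ?_⟩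
        have := hH _ (H.inv_mem hh) _ (H.mul_mem (hgH k hk) (H.inv_mem hk))
        calc g * (h * k) * g⁻¹ * (h * k)⁻¹
            = g * h * g⁻¹ * ((g * k * g⁻¹ * k⁻¹) * h⁻¹) := by group
          _ = g * h * g⁻¹ * h⁻¹ * (g * k * g⁻¹ * k⁻¹) := by rw [← this, mul_assoc]; group
      inv_mem' := by
        rintro _ ⟨h, hh, rfl⟩
        refine ⟨h⁻¹, H.inv_mem hh, ?_⟩
        have := hH _ (hgH _ (H.inv_mem hh)) _ hh
        rw [inv_inv, this]
        group }
  have hDH : D ≤ H := by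
    rintro _ ⟨h, hh, rfl⟩
    exact H.mul_mem (hgH h hh) (H.inv_mem hh)
  have : Finite D := Finite.of_injective _ (Subgroup.inclusion_injective hDH)
  have hD := τ.eq_one_of_fixedPointFree (K := K) (g := g) D
    (by
      intro h0
      obtain ⟨k, hk⟩ := Subgroup.card_dvd_of_le hDH
      exact hcard (by rw [hk, Nat.cast_mul, h0, zero_mul]))
    (by
      rintro _ ⟨h, hh, rfl⟩
      exact ⟨g * h * g⁻¹, hgH h hh, by group⟩)
    (by
      rintro _ ⟨h, hh, rfl⟩ hc
      refine mul_inv_eq_one.mpr (MulAut.apply_eq_self_of_apply_mul_inv (φ := MulAut.conj g) (q := h)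
        (by rw [← map_pow, hgr, map_one]) hcop ?_ ?_)
      · have := pow_card_eq_one' (x := (⟨_, H.mul_mem (hgH h hh) (H.inv_mem hh)⟩ : H))
        exact congrArg Subtype.val this
      · exact mul_inv_eq_iff_eq_mul.mpr hc.eq.symm)
    hr hgr hN
  intro h hh
  have := hτ ((hD _ ⟨h, hh, rfl⟩).trans (map_one τ).symm)
  rw [mul_inv_eq_one, mul_inv_eq_iff_eq_mul] at this
  exact this.symm

end PrimeOrder

section MinimalAut

variable {Q : Type*} [Group Q] {φ : MulAut Q} {r : ℕ}

theorem MulAut.le_center_of_minimal [Finite Q] (hφr : φ ^ r = 1) (hcop : (Nat.card Q).Coprime r)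
    (hmin : ∀ H : Subgroup Q, (∀ x ∈ H, φ x ∈ H) → H ≠ ⊤ → ∀ x ∈ H, φ x = x)
    (hφ : φ ≠ 1) {H : Subgroup Q} (hn : H.Normal) (hH : ∀ x ∈ H, φ x ∈ H) (htop : H ≠ ⊤) :
    H ≤ Subgroup.center Q := by
  have hfix := hmin H hH htop
  have hCinv : ∀ x ∈ Subgroup.centralizer (H : Set Q), φ x ∈ Subgroup.centralizer (H : Set Q) := by
    intro x hx h hh
    rw [← hfix h hh, ← map_mul, ← map_mul, hx h hh]
  by_cases hC : Subgroup.centralizer (H : Set Q) = ⊤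
  · exact Subgroup.centralizer_eq_top_iff_subset.mp hC
  · refine absurd (MulEquiv.ext fun q ↦ ?_) hφ
    refine MulAut.apply_eq_self_of_apply_mul_inv hφr hcop pow_card_eq_one' (hmin _ hCinv hC _ ?_)
    intro h hh
    have h1 : q⁻¹ * h * q ∈ H := by simpa using hn.conj_mem h hh q⁻¹
    have h2 : φ q * (q⁻¹ * h * q) * φ q⁻¹ = h := by
      nth_rewrite 1 [← hfix _ h1]
      rw [← map_mul, ← map_mul, show q * (q⁻¹ * h * q) * q⁻¹ = h by group, hfix h hh]
    calc h * (φ q * q⁻¹) = φ q * (q⁻¹ * h * q) * φ q⁻¹ * (φ q * q⁻¹) := by rw [h2]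
      _ = φ q * q⁻¹ * h := by rw [map_inv]; group

theorem MulAut.mem_center_of_minimal [Finite Q] (hφr : φ ^ r = 1)
    (hcop : (Nat.card Q).Coprime r)
    (hmin : ∀ H : Subgroup Q, (∀ x ∈ H, φ x ∈ H) → H ≠ ⊤ → ∀ x ∈ H, φ x = x)
    (hφ : φ ≠ 1) (hφZ : ∀ z ∈ Subgroup.center Q, φ z = z)
    (hcl : commutator Q ≤ Subgroup.center Q) {x : Q}
    (hx : φ x * x⁻¹ ∈ Subgroup.center Q) : x ∈ Subgroup.center Q := by
  let C : Subgroup Q := φ.toMonoidHom.eqLocus (MonoidHom.id Q)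
  have hCn : C.Normal := by
    refine ⟨fun y hy q ↦ ?_⟩
    change φ y = y at hy
    change φ (q * y * q⁻¹) = q * y * q⁻¹
    have h1 : q * y * q⁻¹ * y⁻¹ ∈ Subgroup.center Q :=
      hcl (Subgroup.commutator_mem_commutator (Subgroup.mem_top q) (Subgroup.mem_top y))
    rw [← inv_mul_cancel_right (q * y * q⁻¹) y, map_mul, hφZ _ h1, hy]
  refine MulAut.le_center_of_minimal hφr hcop hmin hφ hCn (fun y hy ↦ ?_) (fun htop ↦ hφ ?_)
    (show φ x = x from MulAut.apply_eq_self_of_apply_mul_inv hφr hcop pow_card_eq_one' (hφZ _ hx))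
  · change φ y = y at hy
    rwa [hy]
  · exact MulEquiv.ext fun q ↦ (htop ▸ Subgroup.mem_top q : q ∈ C)

end MinimalAut

theorem Subgroup.exists_minimal_not_commute {G : Type*} [Group G] [Finite G] (U : Subgroup G)
    (g : G) (hU : ∀ u ∈ U, g * u * g⁻¹ ∈ U) (hcomm : ∃ u ∈ U, u * g ≠ g * u) :
    ∃ Q ≤ U, (∀ q ∈ Q, g * q * g⁻¹ ∈ Q) ∧ (∃ q ∈ Q, q * g ≠ g * q) ∧
      ∀ H ≤ Q, (∀ h ∈ H, g * h * g⁻¹ ∈ H) → H ≠ Q → ∀ h ∈ H, h * g = g * h := by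
  obtain ⟨Q, ⟨hQU, hQ, hQg⟩, hmin⟩ := Set.Finite.exists_minimal
    (s := {H : Subgroup G | H ≤ U ∧ (∀ h ∈ H, g * h * g⁻¹ ∈ H) ∧ ∃ h ∈ H, h * g ≠ g * h})
    (Set.toFinite _) ⟨U, le_rfl, hU, hcomm⟩
  refine ⟨Q, hQU, hQ, hQg, fun H hHQ hH hne h hh ↦ ?_⟩
  by_contra hhg
  exact hne (le_antisymm hHQ (hmin ⟨hHQ.trans hQU, hH, h, hh, hhg⟩ hHQ))

theorem exists_index_center_eq_sq_of_minimal {K G M : Type*} [Field K] [IsAlgClosed K] [Group G]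
    [Finite G] [AddCommGroup M] [Module K M] (τ : G →* Module.End K M)
    (hτ : Function.Injective τ) {g : G} {r p : ℕ} [Fact p.Prime] (Q : Subgroup G)
    (hQp : IsPGroup p Q) (hcard : (Nat.card Q : K) ≠ 0) (hcop : (Nat.card Q).Coprime r)
    (hQ : ∀ q ∈ Q, g * q * g⁻¹ ∈ Q) (hQg : ∃ q ∈ Q, q * g ≠ g * q)
    (hmin : ∀ H ≤ Q, (∀ h ∈ H, g * h * g⁻¹ ∈ H) → H ≠ Q → ∀ h ∈ H, h * g = g * h)
    (hr : r.Prime) (hrK : (r : K) ≠ 0) (hgr : g ^ r = 1)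
    (hN : ∑ i ∈ Finset.range r, τ g ^ i = 0) :
    ∃ n, 1 < n ∧ n ^ 2 ∣ Nat.card Q ∧ n + 1 = r := by
  have := Fintype.ofFinite Q
  have hgQ : g ∈ Subgroup.normalizer (Q : Set G) := Subgroup.mem_normalizer_fintype hQ
  let φ : MulAut Q := Q.normalizerMonoidHom ⟨g, hgQ⟩
  have hφcoe (x : Q) : (φ x : G) = g * x * g⁻¹ := rfl
  have hφr : φ ^ r = 1 := by
    rw [← map_pow, show (⟨g, hgQ⟩ : Subgroup.normalizer (Q : Set G)) ^ r = 1 from Subtype.ext hgr,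
      map_one]
  have hfix (x : Q) : φ x = x ↔ (x : G) * g = g * x := by
    rw [Subtype.ext_iff, hφcoe, mul_inv_eq_iff_eq_mul, eq_comm]
  have hφ1 : φ ≠ 1 := by
    intro h1
    obtain ⟨q, hq, hqg⟩ := hQg
    exact hqg ((hfix ⟨q, hq⟩).mp (by rw [h1, MulAut.one_apply]))
  have hminφ (H : Subgroup Q) (hH : ∀ x ∈ H, φ x ∈ H) (htop : H ≠ ⊤) : ∀ x ∈ H, φ x = x := by
    intro x hx
    refine (hfix x).mpr (hmin (H.map Q.subtype) (Subgroup.map_subtype_le H) ?_ ?_ x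
      ⟨x, hx, rfl⟩)
    · rintro _ ⟨y, hy, rfl⟩
      exact ⟨φ y, hH y hy, rfl⟩
    · intro h
      refine htop (Subgroup.map_injective Q.subtype_injective ?_)
      rw [h, ← MonoidHom.range_eq_map, Subgroup.range_subtype]
  have hZtop : Subgroup.center Q ≠ ⊤ := by
    intro htop
    obtain ⟨q, hq, hqg⟩ := hQg
    refine hqg (τ.commute_of_forall_mul_comm hτ Q hcard hcop hQ (fun x hx y hy ↦ ?_) hr hgr hN q hq)
    have : (⟨x, hx⟩ : Q) ∈ Subgroup.center Q := htop ▸ Subgroup.mem_top _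
    exact (congrArg Subtype.val (Subgroup.mem_center_iff.mp this ⟨y, hy⟩)).symm
  have hφZ := hminφ (Subgroup.center Q)
    (fun x hx ↦ (Subgroup.Characteristic.fixed (H := Subgroup.center Q) inferInstance φ).ge hx)
      hZtop
  have hnt : Nontrivial Q := by
    by_contra h
    rw [not_nontrivial_iff_subsingleton] at h
    exact hZtop (Subsingleton.elim _ _)
  have := hQp.isNilpotent
  have hcl : commutator Q ≤ Subgroup.center Q :=
    MulAut.le_center_of_minimal hφr hcop hminφ hφ1 inferInstance
      (fun x hx ↦ (Subgroup.Characteristic.fixed (H := commutator Q) inferInstance φ).ge hx)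
      (Group.IsSolvable.commutator_lt_top_of_nontrivial Q).ne
  obtain ⟨a, ha⟩ : ∃ a, a ∉ Subgroup.center Q := by
    by_contra! h
    exact hZtop ((Subgroup.eq_top_iff' _).mpr h)
  obtain ⟨b, hb⟩ : ∃ b, b * a ≠ a * b := by
    by_contra! h
    exact ha (Subgroup.mem_center_iff.mpr h)
  obtain ⟨n, hn, hnr⟩ := exists_index_center_eq_sq (τ.comp Q.subtype)
    (by rwa [← Nat.card_eq_fintype_card]) φ hφZ
    (fun x ↦ MulAut.mem_center_of_minimal hφr hcop hminφ hφ1 hφZ hcl)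
    (fun x y ↦ hcl (Subgroup.commutator_mem_commutator (Subgroup.mem_top x) (Subgroup.mem_top y)))
    (fun H hHn hH htop ↦ MulAut.le_center_of_minimal hφr hcop hminφ hφ1 hHn hH htop)
    b a (fun h ↦ hb (commutatorElement_eq_one_iff_mul_comm.mp
      (Q.subtype_injective (hτ (h.trans (map_one τ).symm)))))
    hr hrK hφr (τ g)
    (fun q ↦ by
      simp only [MonoidHom.comp_apply, Subgroup.subtype_apply, hφcoe, ← map_mul]
      rw [inv_mul_cancel_right])
    hN
  refine ⟨n, ?_, hn ▸ Subgroup.index_dvd_card _, hnr⟩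
  by_contra! hle
  refine hZtop (Subgroup.index_eq_one.mp ?_)
  have h0 : (Subgroup.center Q).index ≠ 0 := Subgroup.index_ne_zero_of_finite
  interval_cases n <;> simp_all

theorem Module.End.exists_apply_eq_self_of_sum_pow_ne_zero {K M : Type*} [Semiring K]
    [AddCommGroup M] [Module K M] (f : Module.End K M) {r : ℕ} (hf : f ^ r = 1)
    (h : ∑ i ∈ Finset.range r, f ^ i ≠ 0) : ∃ y ≠ 0, f y = y := by
  obtain ⟨x, hx⟩ : ∃ x, (∑ i ∈ Finset.range r, f ^ i) x ≠ 0 := by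
    by_contra! h0
    exact h (LinearMap.ext h0)
  refine ⟨_, hx, sub_eq_zero.mp ?_⟩
  have h1 := congrArg (fun e : Module.End K M ↦ e x) (mul_geom_sum f r)
  simpa [hf] using h1

theorem Module.End.exists_apply_eq_self_of_pow_char {K M : Type*} [Field K] [AddCommGroup M]
    [Module K M] [Nontrivial M] {p : ℕ} [Fact p.Prime] [CharP K p] (f : Module.End K M)
    (hf : f ^ p = 1) : ∃ y ≠ 0, f y = y := by
  have : CharP (Module.End K M) p := charP_of_injective_algebraMap' K p
  have h : (f - 1) ^ p = 0 := by
    rw [sub_pow_char_of_commute _ (Commute.one_right f), hf, one_pow, sub_self]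
  by_contra! hno
  have hinj : Function.Injective (f - 1 : Module.End K M) := by
    refine (injective_iff_map_eq_zero _).mpr fun x hx ↦ ?_
    by_contra hx0
    exact hno x hx0 (sub_eq_zero.mp hx)
  have hpow : Function.Injective ((f - 1) ^ p : Module.End K M) := by
    rw [Module.End.coe_pow]
    exact hinj.iterate p
  obtain ⟨y, hy⟩ := exists_ne (0 : M)
  exact hy (hpow (by rw [h]; rfl))

theorem eq_two_and_exists_eq_fermat {v r n m : ℕ} (hv : v.Prime) (hr : r.Prime) (hn : 1 < n)
    (hdvd : n ^ 2 ∣ v ^ m) (hnr : n + 1 = r) : v = 2 ∧ ∃ k : ℕ, r = 2 ^ (2 ^ k) + 1 := by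
  obtain ⟨l, -, rfl⟩ := (Nat.dvd_prime_pow hv).mp ((dvd_pow_self n two_ne_zero).trans hdvd)
  have hl : l ≠ 0 := by rintro rfl; simp at hn
  have hv2 : v = 2 := by
    rcases hv.eq_two_or_odd' with h | h
    · exact h
    · have h1 : Even r := hnr ▸ (h.pow.add_odd odd_one)
      have := (hr.even_iff).mp h1
      lia
  subst hv2
  obtain ⟨k, rfl⟩ := Nat.pow_of_pow_add_prime one_lt_two hl (hnr ▸ hr)
  exact ⟨rfl, k, hnr.symm⟩

theorem commute_and_fermat_of_sum_pow_eq_zero {K G M : Type*} [Field K] [IsAlgClosed K]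
    [Group G] [Finite G] [AddCommGroup M] [Module K M] (τ : G →* Module.End K M)
    (hτ : Function.Injective τ) {v r : ℕ} (hv : v.Prime) (hr : r.Prime) (hvr : v ≠ r)
    (hvK : (v : K) ≠ 0) (hrK : (r : K) ≠ 0) (U : Subgroup G) {m : ℕ} (hU : Nat.card U = v ^ m)
    {g : G} (hUg : ∀ u ∈ U, g * u * g⁻¹ ∈ U) (hgr : g ^ r = 1) (hcomm : ∃ u ∈ U, u * g ≠ g * u)
    (hN : ∑ i ∈ Finset.range r, τ g ^ i = 0) :
    (∃ u ∈ U, u ≠ 1 ∧ u * g = g * u) ∧ (∃ a ∈ U, ∃ b ∈ U, a * b ≠ b * a) ∧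
      (v = 2 ∧ ∃ k : ℕ, r = 2 ^ (2 ^ k) + 1) := by
  have := Fact.mk hv
  have hUK : (Nat.card U : K) ≠ 0 := by
    rw [hU, Nat.cast_pow]
    exact pow_ne_zero _ hvK
  have hUr : (Nat.card U).Coprime r := hU ▸ ((Nat.coprime_primes hv hr).mpr hvr).pow_left m
  refine ⟨?_, ?_, ?_⟩
  · by_contra! h
    obtain ⟨u, hu, hug⟩ := hcomm
    have h1 := τ.eq_one_of_fixedPointFree U hUK hUg
      (fun x hx hxg ↦ by_contra fun hx1 ↦ h x hx hx1 hxg) hr hgr hN u hu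
    rw [hτ (h1.trans (map_one τ).symm)] at hug
    simp at hug
  · by_contra! h
    obtain ⟨u, hu, hug⟩ := hcomm
    exact hug (τ.commute_of_forall_mul_comm hτ U hUK hUr hUg h hr hgr hN u hu)
  · obtain ⟨Q, hQU, hQ, hQg, hmin⟩ := U.exists_minimal_not_commute g hUg hcomm
    have hQcard := Subgroup.card_dvd_of_le hQU
    obtain ⟨n, hn, hdvd, hnr⟩ := exists_index_center_eq_sq_of_minimal τ hτ Q
      ((IsPGroup.of_card hU).to_le hQU)
      (fun h ↦ hUK (by obtain ⟨k, hk⟩ := hQcard; rw [hk, Nat.cast_mul, h, zero_mul]))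
      (hUr.coprime_dvd_left hQcard) hQ hQg hmin hr hrK hgr hN
    exact eq_two_and_exists_eq_fermat hv hr hn (hdvd.trans (hU ▸ hQcard)) hnr

theorem hall_higman_type
    (v r : ℕ) (hv : v.Prime) (hr : r.Prime) (hvr : v ≠ r)
    (G : Type*) [Group G] [Finite G]
    -- `G` is a semidirect product of a normal `v`-subgroup `U` and `⟨g⟩` of order `r`
    (U : Subgroup G) (hUn : U.Normal) (hU : ∃ n : ℕ, Nat.card U = v ^ n)
    (g : G) (hg : orderOf g = r)
    (hinter : U ⊓ Subgroup.zpowers g = ⊥) (hjoin : U ⊔ Subgroup.zpowers g = ⊤)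
    -- `[U, g] ≠ 1`
    (hcomm : ∃ u ∈ U, u * g ≠ g * u)
    -- `G` acts faithfully and linearly on a vector space `W` of characteristic `w ≠ v`
    (w : ℕ) (hwp : w.Prime) (hwv : w ≠ v)
    (F : Type*) [Field F] [CharP F w]
    (W : Type*) [AddCommGroup W] [Module F W]
    (ρ : G →* (W ≃ₗ[F] W)) (hfaithful : Function.Injective ρ) :
    -- either the natural semidirect product `W ⋊ G` has an element of order `r·w`,
    -- equivalently some element of order `r` in `G` has a nonzero fixed vector in `W`, ...
    (∃ x : G, orderOf x = r ∧ ∃ y : W, y ≠ 0 ∧ ρ x y = y) ∨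
    -- ... or all of the following hold
    ((∃ u ∈ U, u ≠ 1 ∧ u * g = g * u) ∧
      (∃ a ∈ U, ∃ b ∈ U, a * b ≠ b * a) ∧
      (v = 2 ∧ ∃ k : ℕ, r = 2 ^ (2 ^ k) + 1)) := by
  by_cases hfix : ∃ y : W, y ≠ 0 ∧ ρ g y = y
  · exact Or.inl ⟨g, hg, hfix⟩
  refine Or.inr ?_
  have := Fact.mk hwp
  obtain ⟨m, hU⟩ := hU
  have hgr : g ^ r = 1 := hg ▸ pow_orderOf_eq_one g
  let σ : G →* Module.End F W := (LinearEquiv.automorphismGroup.toLinearMapMonoidHom).comp ρ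
  have hσ : Function.Injective σ := fun x y h ↦ hfaithful (LinearEquiv.toLinearMap_injective h)
  have hσr : σ g ^ r = 1 := by rw [← map_pow, hgr, map_one]
  have hσN : ∑ i ∈ Finset.range r, σ g ^ i = 0 := by
    by_contra h
    exact hfix ((σ g).exists_apply_eq_self_of_sum_pow_ne_zero hσr h)
  have hW : Nontrivial W := by
    by_contra h
    rw [not_nontrivial_iff_subsingleton] at h
    obtain ⟨u, -, hu⟩ := hcomm
    exact hu (hσ (Subsingleton.elim _ _))
  have hrF : (r : F) ≠ 0 := by
    intro h
    have hwr : w = r := (Nat.prime_dvd_prime_iff_eq hwp hr).mp ((CharP.cast_eq_zero_iff F w r).mp h)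
    exact hfix ((σ g).exists_apply_eq_self_of_pow_char (p := w) (hwr ▸ hσr))
  have hvF : (v : F) ≠ 0 := fun h ↦
    hwv ((Nat.prime_dvd_prime_iff_eq hwp hv).mp ((CharP.cast_eq_zero_iff F w v).mp h))
  let K := AlgebraicClosure F
  let τ : G →* Module.End K (TensorProduct F K W) :=
    ((Module.End.baseChangeHom F K W : _ →ₐ[F] _) : _ →* _).comp σ
  have hτ : Function.Injective τ := (LinearMap.baseChangeHom_injective F W K).comp hσ
  have hN : ∑ i ∈ Finset.range r, τ g ^ i = 0 := by
    have := congrArg (Module.End.baseChangeHom F K W) hσN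
    simpa [τ] using this
  have hcast {n : ℕ} (h : (n : F) ≠ 0) : (n : K) ≠ 0 := by
    rw [← map_natCast (algebraMap F K)]
    exact (map_ne_zero _).mpr h
  exact commute_and_fermat_of_sum_pow_eq_zero τ hτ hv hr hvr (hcast hvF) (hcast hrF) U hU
    (fun u hu ↦ hUn.conj_mem u hu g) hgr hcomm hN
end
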